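/- arXiv:1706.07687 — 2 statements merged into one kernel-verified Lean document; each statement's English description precedes it below -/
import Mathlib

section
/- Let K ⊆ ℝⁿ be a Hölder detour set with complementary components Ω₀, Ω₁, Ω₂, … (Ω₀ unbounded). Then K has n-dimensional Lebesgue measure zero, and diam(Ω_k) → 0 as k → ∞. -/
open MeasureTheory Metric Set Filter
open scoped ENNReal NNReal Topology

/-- The line through the point `w` in the direction `v`. -/
def lineThrough {n : ℕ} (w v : EuclideanSpace ℝ (Fin n)) : Set (EuclideanSpace ℝ (Fin n)) :=
  {x | ∃ t : ℝ, x = w + t • v}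

/-- The line `L` has the detour property with respect to the family `Ω` of complementary
components and the closed ball `B`: for every `ε > 0` there is a path `γ` whose trace lies
within Hausdorff distance `ε` of `L ∩ B`, such that (i) the trace of `γ` is contained in
`⋃ k, closure (Ω k)`; (ii) `γ` meets only finitely many of the sets `closure (Ω k)`; and
(iii) every `closure (Ω k)` met by `γ` is also met by `L`. -/
def HasDetourProperty {n : ℕ} (Ω : ℕ → Set (EuclideanSpace ℝ (Fin n)))
    (B : Set (EuclideanSpace ℝ (Fin n))) (L : Set (EuclideanSpace ℝ (Fin n))) : Prop :=
  ∀ ε > (0 : ℝ), ∃ γ : ℝ → EuclideanSpace ℝ (Fin n), ContinuousOn γ (Icc 0 1) ∧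
    hausdorffDist (γ '' Icc 0 1) (L ∩ B) ≤ ε ∧
    γ '' Icc 0 1 ⊆ ⋃ k, closure (Ω k) ∧
    {k | (γ '' Icc 0 1 ∩ closure (Ω k)).Nonempty}.Finite ∧
    {k | (γ '' Icc 0 1 ∩ closure (Ω k)).Nonempty} ⊆ {k | (L ∩ closure (Ω k)).Nonempty}

/-- `K` is a detour set with complementary components `Ω 0, Ω 1, Ω 2, …`:
`K` is compact, `Ω` is an injective enumeration of the (infinitely many) connected components
of the complement of `K`, with `Ω 0` the unbounded component and `Ω k`, `k ≥ 1`, the bounded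
ones, and there exist a closed ball `B` containing `K` in its interior and `n` linearly
independent directions such that, for each of these directions, almost every line parallel to
it (lines parallel to `v` being parametrized by the points of the orthogonal complement of `v`,
equipped with its Lebesgue measure) has the detour property. -/
structure IsDetourSet (n : ℕ) (K : Set (EuclideanSpace ℝ (Fin n)))
    (Ω : ℕ → Set (EuclideanSpace ℝ (Fin n))) : Prop where
  compact : IsCompact K
  inj : Function.Injective Ω
  component : ∀ k, ∃ x ∈ Kᶜ, Ω k = connectedComponentIn Kᶜ x
  surj : ∀ x ∈ Kᶜ, ∃ k, Ω k = connectedComponentIn Kᶜ x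
  unbounded : ¬ Bornology.IsBounded (Ω 0)
  bounded : ∀ k : ℕ, k ≠ 0 → Bornology.IsBounded (Ω k)
  detour : ∃ (x : EuclideanSpace ℝ (Fin n)) (r : ℝ), 0 < r ∧ K ⊆ ball x r ∧
    ∃ v : Fin n → EuclideanSpace ℝ (Fin n), LinearIndependent ℝ v ∧
      ∀ i : Fin n, ∀ᵐ w : ↥(Submodule.span ℝ {v i})ᗮ,
        HasDetourProperty Ω (closedBall x r)
          (lineThrough (w : EuclideanSpace ℝ (Fin n)) (v i))

/-- The distance `δ_D(x)` of `x` to the boundary of `D`. -/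
noncomputable def distBoundary {n : ℕ} (D : Set (EuclideanSpace ℝ (Fin n)))
    (x : EuclideanSpace ℝ (Fin n)) : ℝ :=
  Metric.infDist x (frontier D)

/-- The quasihyperbolic distance between two points of `D`: the infimum, over all rectifiable
paths in `D` joining `x` to `y` (parametrized by arclength, i.e. `1`-Lipschitz on `[0, L]`),
of the arclength integral of `1 / δ_D` along the path. -/
noncomputable def qhDist {n : ℕ} (D : Set (EuclideanSpace ℝ (Fin n)))
    (x y : EuclideanSpace ℝ (Fin n)) : ℝ≥0∞ :=
  ⨅ (L : ℝ) (γ : ℝ → EuclideanSpace ℝ (Fin n)) (_ : 0 ≤ L)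
    (_ : LipschitzOnWith 1 γ (Icc 0 L)) (_ : γ 0 = x) (_ : γ L = y)
    (_ : γ '' Icc 0 L ⊆ D),
    ∫⁻ t in Icc 0 L, ENNReal.ofReal (1 / distBoundary D (γ t))

/-- `D` is an `(α, c)`-Hölder domain with basepoint `x₀`: `D` is open, `x₀ ∈ D`,
`α ∈ (0, 1]`, `c > 0`, and `k_D(x, x₀) ≤ (1/α) log (δ_D(x₀) / δ_D(x)) + c` for all `x ∈ D`. -/
structure IsHolderDomain {n : ℕ} (D : Set (EuclideanSpace ℝ (Fin n))) (α c : ℝ)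
    (x₀ : EuclideanSpace ℝ (Fin n)) : Prop where
  isOpen : IsOpen D
  basepoint_mem : x₀ ∈ D
  alpha_pos : 0 < α
  alpha_le_one : α ≤ 1
  c_pos : 0 < c
  qh_bound : ∀ x ∈ D, qhDist D x x₀ ≤
    ENNReal.ofReal ((1 / α) * Real.log (distBoundary D x₀ / distBoundary D x) + c)

/-- A quasihyperbolic geodesic in `D`, parametrized by arclength on `[0, L]`: a `1`-Lipschitz
curve in `D` such that for any two points on the curve their quasihyperbolic distance equals
the integral of `1 / δ_D` over the subpath between them. -/
structure IsQHGeodesic {n : ℕ} (D : Set (EuclideanSpace ℝ (Fin n))) (L : ℝ)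
    (γ : ℝ → EuclideanSpace ℝ (Fin n)) : Prop where
  nonneg : 0 ≤ L
  lipschitz : LipschitzOnWith 1 γ (Icc 0 L)
  mem : γ '' Icc 0 L ⊆ D
  geodesic : ∀ s ∈ Icc 0 L, ∀ t ∈ Icc 0 L, s ≤ t →
    qhDist D (γ s) (γ t) = ∫⁻ u in Icc s t, ENNReal.ofReal (1 / distBoundary D (γ u))

/-- `K` is a Hölder detour set: a detour set such that, for some `α ∈ (0,1]` and `c > 0`,
every bounded complementary component `Ω k` (`k ≥ 1`) is an `(α, c)`-Hölder domain, and
there is a ball `B(0, R)` containing `∂(Ω 0)` such that `Ω 0 ∩ B(0, R)` is an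
`(α, c)`-Hölder domain. -/
structure IsHolderDetourSet (n : ℕ) (K : Set (EuclideanSpace ℝ (Fin n)))
    (Ω : ℕ → Set (EuclideanSpace ℝ (Fin n))) : Prop where
  detour : IsDetourSet n K Ω
  holder : ∃ α c : ℝ,
    (∀ k : ℕ, k ≠ 0 → ∃ x₀, IsHolderDomain (Ω k) α c x₀) ∧
    ∃ R : ℝ, frontier (Ω 0) ⊆ ball (0 : EuclideanSpace ℝ (Fin n)) R ∧
      ∃ x₀, IsHolderDomain (Ω 0 ∩ ball (0 : EuclideanSpace ℝ (Fin n)) R) α c x₀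


lemma qh_lower {n : ℕ} {D : Set (EuclideanSpace ℝ (Fin n))} {x x₀ ξ : EuclideanSpace ℝ (Fin n)}
    {s r : ℝ} (h : ℝ → ℝ) (hpos : ∀ y ∈ D, 0 < distBoundary D y)
    (hx : dist x ξ ≤ s) (hr : r ≤ dist ξ x₀)
    (hb : ∀ t ∈ Icc 0 (r - s), ∀ y ∈ D, dist y ξ ≤ s + t → distBoundary D y ≤ h t) :
    ∫⁻ t in Icc 0 (r - s), ENNReal.ofReal (1 / h t) ≤ qhDist D x x₀ := by
  unfold qhDist
  refine le_iInf fun L => le_iInf fun γ => le_iInf fun hL => le_iInf fun hlip => le_iInf fun h0 =>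
    le_iInf fun h1 => le_iInf fun hsub => ?_
  have hd : ∀ t ∈ Icc 0 L, dist x (γ t) ≤ t := by
    intro t ht
    have := hlip.dist_le_mul 0 ⟨le_rfl, hL⟩ t ht
    rw [h0] at this
    simpa [abs_of_nonneg ht.1] using this
  have hrs : r - s ≤ L := by
    have h2 := hd L ⟨hL, le_rfl⟩
    rw [h1] at h2
    have h3 := dist_triangle ξ x x₀
    rw [dist_comm ξ x] at h3
    linarith
  calc ∫⁻ t in Icc 0 (r - s), ENNReal.ofReal (1 / h t)
      ≤ ∫⁻ t in Icc 0 (r - s), ENNReal.ofReal (1 / distBoundary D (γ t)) := by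
        refine setLIntegral_mono' measurableSet_Icc fun t ht => ENNReal.ofReal_le_ofReal ?_
        have htL : t ∈ Icc 0 L := ⟨ht.1, ht.2.trans hrs⟩
        have hm : γ t ∈ D := hsub ⟨t, htL, rfl⟩
        refine one_div_le_one_div_of_le (hpos _ hm) (hb t ht _ hm ?_)
        have h3 := dist_triangle (γ t) x ξ
        have := hd t htL
        rw [dist_comm] at this
        linarith
    _ ≤ _ := lintegral_mono_set (Icc_subset_Icc_right hrs)

lemma frontier_nonempty_of_bdd {n : ℕ} (hn : n ≠ 0) {D : Set (EuclideanSpace ℝ (Fin n))}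
    (hne : D.Nonempty) (hb : Bornology.IsBounded D) : (frontier D).Nonempty := by
  have : Nonempty (Fin n) := ⟨⟨0, Nat.pos_of_ne_zero hn⟩⟩
  have : Nontrivial (EuclideanSpace ℝ (Fin n)) := inferInstance
  by_contra h
  rw [not_nonempty_iff_eq_empty, frontier_eq_empty_iff] at h
  rcases h with h | h
  · exact hne.ne_empty h
  · rw [h] at hb
    exact NormedSpace.unbounded_univ ℝ (EuclideanSpace ℝ (Fin n)) hb

lemma distBoundary_pos {n : ℕ} (hn : n ≠ 0) {D : Set (EuclideanSpace ℝ (Fin n))}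
    (ho : IsOpen D) (hb : Bornology.IsBounded D) {y : EuclideanSpace ℝ (Fin n)} (hy : y ∈ D) :
    0 < distBoundary D y := by
  have hne := frontier_nonempty_of_bdd hn ⟨y, hy⟩ hb
  unfold distBoundary
  rw [← isClosed_frontier.notMem_iff_infDist_pos hne]
  rw [ho.frontier_eq]
  exact fun h => h.2 hy

lemma ball_disjoint {n : ℕ} {D : Set (EuclideanSpace ℝ (Fin n))} (y : EuclideanSpace ℝ (Fin n)) :
    Disjoint (ball y (distBoundary D y)) (frontier D) := disjoint_ball_infDist

/-- const bound version with real conclusions -/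
lemma qh_const {n : ℕ} (hn : n ≠ 0) {D : Set (EuclideanSpace ℝ (Fin n))} {α c : ℝ}
    {x₀ : EuclideanSpace ℝ (Fin n)} (hD : IsHolderDomain D α c x₀) (hb : Bornology.IsBounded D)
    {x ξ : EuclideanSpace ℝ (Fin n)} {s r m : ℝ} (hxD : x ∈ D) (hm : 0 < m) (hsr : s < r)
    (hx : dist x ξ ≤ s) (hr : r ≤ dist ξ x₀)
    (hP : ∀ y ∈ D, dist y ξ ≤ r → distBoundary D y ≤ m) :
    distBoundary D x ≤ Real.exp (α * c) * distBoundary D x₀ * Real.exp (- (α * ((r - s) / m))) := by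
  have hpos : ∀ y ∈ D, 0 < distBoundary D y := fun y hy => distBoundary_pos hn hD.isOpen hb hy
  have h1 := qh_lower (D := D) (x₀ := x₀) (fun _ => m) hpos hx hr
    (fun t ht y hy hd => hP y hy (by linarith [ht.2]))
  have h2 := h1.trans (hD.qh_bound x hxD)
  have hα := hD.alpha_pos
  rw [setLIntegral_const, Real.volume_Icc, sub_zero, ← ENNReal.ofReal_mul (by positivity),
    ENNReal.ofReal_le_ofReal_iff'] at h2
  have hq : 0 < (r - s) / m := div_pos (by linarith) hm
  have h3 : (r - s) / m ≤ 1 / α * Real.log (distBoundary D x₀ / distBoundary D x) + c := by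
    have e : 1 / m * (r - s) = (r - s) / m := by ring
    rw [e] at h2
    rcases h2 with h2 | h2
    · exact h2
    · linarith
  have p0 := hpos x₀ hD.basepoint_mem
  have px := hpos x hxD
  rw [Real.log_div p0.ne' px.ne'] at h3
  have h4 : α * ((r - s) / m) ≤ Real.log (distBoundary D x₀) - Real.log (distBoundary D x) + α * c := by
    have := mul_le_mul_of_nonneg_left h3 hα.le
    have e : α * (1 / α * (Real.log (distBoundary D x₀) - Real.log (distBoundary D x)) + c) =
      Real.log (distBoundary D x₀) - Real.log (distBoundary D x) + α * c := by
      field_simp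
    linarith
  calc distBoundary D x = Real.exp (Real.log (distBoundary D x)) := (Real.exp_log px).symm
    _ ≤ Real.exp (α * c + Real.log (distBoundary D x₀) + -(α * ((r - s) / m))) :=
        Real.exp_le_exp.2 (by linarith)
    _ = _ := by rw [Real.exp_add, Real.exp_add, Real.exp_log p0]

lemma base_bound {n : ℕ} (hn : n ≠ 0) {D : Set (EuclideanSpace ℝ (Fin n))} {α c : ℝ}
    {x₀ : EuclideanSpace ℝ (Fin n)} (hD : IsHolderDomain D α c x₀) (hb : Bornology.IsBounded D)
    {y : EuclideanSpace ℝ (Fin n)} (hy : y ∈ D) :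
    distBoundary D y ≤ Real.exp (α * c) * distBoundary D x₀ := by
  have hpos : ∀ y ∈ D, 0 < distBoundary D y := fun y hy => distBoundary_pos hn hD.isOpen hb hy
  have p0 := hpos x₀ hD.basepoint_mem
  have hA : 1 ≤ Real.exp (α * c) := Real.one_le_exp (mul_pos hD.alpha_pos hD.c_pos).le
  by_cases hyx : y = x₀
  · subst hyx
    nlinarith
  obtain ⟨p, hp⟩ := frontier_nonempty_of_bdd hn ⟨y, hy⟩ hb
  obtain ⟨M, hM⟩ := hb.subset_closedBall p
  have hMp : ∀ z ∈ D, distBoundary D z ≤ M := fun z hz =>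
    (infDist_le_dist_of_mem hp).trans (hM hz)
  have hM0 : 0 < M := (hpos y hy).trans_le (hMp y hy)
  have hd : 0 < dist y x₀ := dist_pos.2 hyx
  have := qh_const hn hD hb (ξ := y) (s := 0) (r := dist y x₀) hy hM0 hd (by simp) le_rfl
    (fun z hz _ => hMp z hz)
  refine this.trans (mul_le_of_le_one_right (by positivity) (Real.exp_le_one_iff.2 ?_))
  have := hD.alpha_pos
  rw [sub_zero]
  have : 0 ≤ α * (dist y x₀ / M) := by positivity
  linarith

lemma step_bound {n : ℕ} (hn : n ≠ 0) {D : Set (EuclideanSpace ℝ (Fin n))} {α c : ℝ}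
    {x₀ : EuclideanSpace ℝ (Fin n)} (hD : IsHolderDomain D α c x₀) (hb : Bornology.IsBounded D)
    {ξ : EuclideanSpace ℝ (Fin n)} {Q : ℝ} (hQ : Q = Real.exp (α * c) * distBoundary D x₀)
    (J : ℕ) (s : ℝ) (hs : s ≤ dist ξ x₀)
    (hP : ∀ y ∈ D, dist y ξ ≤ s → distBoundary D y ≤ Q * (1 / 4) ^ J) :
    ∀ y ∈ D, dist y ξ ≤ s - 2 * Q / α * (1 / 2) ^ J → distBoundary D y ≤ Q * (1 / 4) ^ (J + 1) := by
  intro y hy hd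
  have p0 := distBoundary_pos hn hD.isOpen hb hD.basepoint_mem
  have hQ0 : 0 < Q := by rw [hQ]; positivity
  have hα := hD.alpha_pos
  have h := qh_const hn hD hb (m := Q * (1 / 4) ^ J) hy (by positivity)
    (by have : 0 < 2 * Q / α * (1 / 2) ^ J := by positivity
        linarith) hd hs hP
  refine h.trans ?_
  rw [← hQ]
  refine mul_le_mul_of_nonneg_left ?_ hQ0.le
  have e : α * ((s - (s - 2 * Q / α * (1 / 2) ^ J)) / (Q * (1 / 4) ^ J)) = 2 * 2 ^ J := by
    have : (4 : ℝ) ^ J = 2 ^ J * 2 ^ J := by rw [← mul_pow]; norm_num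
    simp only [one_div, inv_pow, this]
    field_simp
    ring
  rw [e]
  have h4 : ((1 : ℝ) / 4) ^ (J + 1) = Real.exp (- ((J + 1) * (2 * Real.log 2))) := by
    rw [← Real.exp_log (show (0 : ℝ) < (1 / 4) ^ (J + 1) by positivity), Real.log_pow]
    congr 1
    rw [one_div, Real.log_inv, show (4 : ℝ) = 2 ^ 2 by norm_num, Real.log_pow]
    push_cast
    ring
  rw [h4]
  refine Real.exp_le_exp.2 (neg_le_neg ?_)
  have h5 : ((J : ℝ) + 1) ≤ 2 ^ J := by exact_mod_cast Nat.lt_two_pow_self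
  have h6 : Real.log 2 ≤ 1 := by linarith [Real.log_two_lt_d9]
  have h7 : 0 ≤ Real.log 2 := Real.log_nonneg (by norm_num)
  nlinarith

lemma iter_bound {n : ℕ} (hn : n ≠ 0) {D : Set (EuclideanSpace ℝ (Fin n))} {α c : ℝ}
    {x₀ : EuclideanSpace ℝ (Fin n)} (hD : IsHolderDomain D α c x₀) (hb : Bornology.IsBounded D)
    {ξ : EuclideanSpace ℝ (Fin n)} {Q : ℝ} (hQ : Q = Real.exp (α * c) * distBoundary D x₀)
    (J : ℕ) (s : ℝ) (hs : s ≤ dist ξ x₀)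
    (hP : ∀ y ∈ D, dist y ξ ≤ s → distBoundary D y ≤ Q * (1 / 4) ^ J) :
    ∀ y ∈ D, s - 4 * Q / α * (1 / 2) ^ J < dist y ξ := by
  have p0 := distBoundary_pos hn hD.isOpen hb hD.basepoint_mem
  have hQ0 : 0 < Q := by rw [hQ]; positivity
  have hα := hD.alpha_pos
  have key : ∀ i : ℕ, ∀ y ∈ D, dist y ξ ≤ s - 4 * Q / α * ((1 / 2) ^ J - (1 / 2) ^ (J + i)) →
      distBoundary D y ≤ Q * (1 / 4) ^ (J + i) := by
    intro i
    induction i with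
    | zero => simpa using hP
    | succ i ih =>
      have h := step_bound hn hD hb hQ (J + i) _ (le_trans ?_ hs) ih
      · intro y hy hd
        refine h y hy (hd.trans (le_of_eq ?_))
        rw [show J + (i + 1) = (J + i) + 1 by ring, pow_succ]
        ring
      · have h1 : ((1 : ℝ) / 2) ^ (J + i) ≤ (1 / 2) ^ J :=
          pow_le_pow_of_le_one (by norm_num) (by norm_num) (by omega)
        have : 0 ≤ 4 * Q / α * ((1 / 2) ^ J - (1 / 2) ^ (J + i)) :=
          mul_nonneg (by positivity) (by linarith)
        linarith
  intro y hy
  by_contra hcon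
  push Not at hcon
  have hy0 := distBoundary_pos hn hD.isOpen hb hy
  have hall : ∀ i : ℕ, distBoundary D y ≤ Q * (1 / 4) ^ (J + i) := by
    intro i
    refine key i y hy (hcon.trans ?_)
    have : 0 ≤ 4 * Q / α * (1 / 2) ^ (J + i) := by positivity
    linarith
  obtain ⟨i, hi⟩ := exists_pow_lt_of_lt_one (show 0 < distBoundary D y / Q by positivity)
    (show (1 : ℝ) / 4 < 1 by norm_num)
  have h1 := hall i
  have h2 : ((1 : ℝ) / 4) ^ (J + i) ≤ (1 / 4) ^ i :=
    pow_le_pow_of_le_one (by norm_num) (by norm_num) (by omega)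
  rw [lt_div_iff₀ hQ0] at hi
  nlinarith

lemma holder_dist {n : ℕ} (hn : n ≠ 0) {D : Set (EuclideanSpace ℝ (Fin n))} {α c : ℝ}
    {x₀ : EuclideanSpace ℝ (Fin n)} (hD : IsHolderDomain D α c x₀) (hb : Bornology.IsBounded D)
    {y : EuclideanSpace ℝ (Fin n)} (hy : y ∈ D) :
    dist y x₀ ≤ 4 * Real.exp (α * c) / α * distBoundary D x₀ := by
  have := iter_bound hn hD hb (ξ := y) rfl 0 (dist y x₀) le_rfl
    (fun z hz _ => by simpa using base_bound hn hD hb hz) y hy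
  simp only [pow_zero, mul_one, dist_self] at this
  have e : 4 * (Real.exp (α * c) * distBoundary D x₀) / α =
    4 * Real.exp (α * c) / α * distBoundary D x₀ := by ring
  linarith

lemma lintegral_log {η s r : ℝ} (hη : 0 < η) (hs : 0 < s) (hsr : s ≤ r) :
    ENNReal.ofReal (1 / η * Real.log (r / s)) =
      ∫⁻ t in Icc 0 (r - s), ENNReal.ofReal (1 / (η * (s + t))) := by
  have hc : ContinuousOn (fun t : ℝ => 1 / (η * (s + t))) (Icc 0 (r - s)) := by
    refine continuousOn_const.div (by fun_prop) fun t ht => ?_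
    have := ht.1
    positivity
  have hint : IntegrableOn (fun t : ℝ => 1 / (η * (s + t))) (Icc 0 (r - s)) :=
    hc.integrableOn_compact isCompact_Icc
  rw [← ofReal_integral_eq_lintegral_ofReal hint]
  · congr 1
    rw [integral_Icc_eq_integral_Ioc, ← intervalIntegral.integral_of_le (by linarith)]
    have e : (fun t : ℝ => 1 / (η * (s + t))) = fun t => 1 / η * (fun x : ℝ => x⁻¹) (s + t) := by
      funext t
      simp only [one_div, mul_inv]
    rw [e, intervalIntegral.integral_const_mul, intervalIntegral.integral_comp_add_left (fun x : ℝ => x⁻¹),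
      integral_inv_of_pos (by linarith) (by linarith)]
    congr 3 <;> ring
  · refine (ae_restrict_mem measurableSet_Icc).mono fun t ht => ?_
    have := ht.1
    simp only [Pi.zero_apply]
    positivity

lemma porous {n : ℕ} (hn : n ≠ 0) {D : Set (EuclideanSpace ℝ (Fin n))} {α c : ℝ}
    {x₀ : EuclideanSpace ℝ (Fin n)} (hD : IsHolderDomain D α c x₀) (hb : Bornology.IsBounded D)
    {ξ : EuclideanSpace ℝ (Fin n)} (hξ : ξ ∈ frontier D) {r₀ : ℝ} (hr₀ : 0 < r₀) :
    ∃ y ∈ D, dist y ξ ≤ r₀ ∧ α / 4 * dist y ξ < distBoundary D y := by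
  by_contra hcon
  push Not at hcon
  have hα := hD.alpha_pos
  have p0 := distBoundary_pos hn hD.isOpen hb hD.basepoint_mem
  have hpos : ∀ y ∈ D, 0 < distBoundary D y := fun y hy => distBoundary_pos hn hD.isOpen hb hy
  have hξc : ξ ∈ closure D := hξ.1
  have hξD : ξ ∉ D := by
    rw [hD.isOpen.frontier_eq] at hξ
    exact hξ.2
  have hne : 0 < dist ξ x₀ := dist_pos.2 fun h => hξD (h ▸ hD.basepoint_mem)
  obtain ⟨r, hr, hrr, hrx⟩ : ∃ r, 0 < r ∧ r ≤ r₀ ∧ r ≤ dist ξ x₀ :=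
    ⟨min r₀ (dist ξ x₀), lt_min hr₀ hne, min_le_left _ _, min_le_right _ _⟩
  obtain ⟨Q, hQ⟩ : ∃ Q, Q = Real.exp (α * c) * distBoundary D x₀ := ⟨_, rfl⟩
  have hQ0 : 0 < Q := by rw [hQ]; positivity
  have hlog2 : 0 < Real.log 2 := Real.log_pos (by norm_num)
  have ht1 : Tendsto (fun J : ℕ => 8 * Q / α * (1 / 2 : ℝ) ^ J) atTop (𝓝 0) := by
    simpa using (tendsto_pow_atTop_nhds_zero_of_lt_one (r := (1 / 2 : ℝ)) (by norm_num)
      (by norm_num)).const_mul (8 * Q / α)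
  have ht2 : Tendsto (fun J : ℕ => (J : ℝ) * Real.log 2) atTop atTop :=
    tendsto_natCast_atTop_atTop.atTop_mul_const hlog2
  obtain ⟨J, hJ1, hJ2⟩ := ((ht1.eventually_lt_const hr).and
    (ht2.eventually_gt_atTop (-2 * (Real.log r - Real.log (8 * Q / α))))).exists
  obtain ⟨s, hs⟩ : ∃ s, s = 8 * Q / α * (1 / 2 : ℝ) ^ J := ⟨_, rfl⟩
  rw [← hs] at hJ1
  have hs0 : 0 < s := by rw [hs]; positivity
  obtain ⟨y, hy, hyd, hyb⟩ : ∃ y ∈ D, dist y ξ ≤ s ∧ Q * (1 / 4) ^ J < distBoundary D y := by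
    by_contra hc
    push Not at hc
    have h := iter_bound hn hD hb hQ J s (by linarith) hc
    obtain ⟨z, hz, hzd⟩ := Metric.mem_closure_iff.1 hξc (s / 2) (by linarith)
    have h2 := h z hz
    have e : 4 * Q / α * (1 / 2) ^ J = s / 2 := by rw [hs]; ring
    rw [e, dist_comm] at h2
    linarith
  have h1 := qh_lower (D := D) (x₀ := x₀) (fun t => α / 4 * (s + t)) hpos hyd hrx (by
    intro t ht z hz hzd
    refine (hcon z hz (by linarith [ht.2])).trans ?_
    exact mul_le_mul_of_nonneg_left hzd (by positivity))
  rw [← lintegral_log (by positivity) hs0 hJ1.le] at h1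
  have h2 := h1.trans (hD.qh_bound y hy)
  rw [ENNReal.ofReal_le_ofReal_iff'] at h2
  have hl : 0 < 1 / (α / 4) * Real.log (r / s) := by
    have : 0 < Real.log (r / s) := Real.log_pos ((one_lt_div hs0).2 hJ1)
    positivity
  have h3 := h2.resolve_right (by linarith)
  have py := hpos y hy
  rw [Real.log_div p0.ne' py.ne', Real.log_div hr.ne' hs0.ne'] at h3
  have hls : Real.log s = Real.log (8 * Q / α) - J * Real.log 2 := by
    rw [hs, Real.log_mul (by positivity) (by positivity), Real.log_pow, one_div, Real.log_inv]
    ring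
  have hly : Real.log (distBoundary D x₀) + α * c - 2 * J * Real.log 2 < Real.log (distBoundary D y) := by
    have h := Real.log_lt_log (by positivity) hyb
    rw [hQ, Real.log_mul (by positivity) (by positivity), Real.log_mul (by positivity) p0.ne',
      Real.log_exp, Real.log_pow, one_div, Real.log_inv, show (4 : ℝ) = 2 ^ 2 by norm_num,
      Real.log_pow] at h
    push_cast at h
    linarith
  have h4 := mul_le_mul_of_nonneg_left h3 hα.le
  have e1 : α * (1 / (α / 4) * (Real.log r - Real.log s)) = 4 * (Real.log r - Real.log s) := by
    field_simp
  have e2 : α * (1 / α * (Real.log (distBoundary D x₀) - Real.log (distBoundary D y)) + c) =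
      Real.log (distBoundary D x₀) - Real.log (distBoundary D y) + α * c := by
    field_simp
  rw [e1, e2, hls] at h4
  linarith

lemma frontier_null {n : ℕ} (hn : n ≠ 0) {D : Set (EuclideanSpace ℝ (Fin n))} {α c : ℝ}
    {x₀ : EuclideanSpace ℝ (Fin n)} (hD : IsHolderDomain D α c x₀) (hb : Bornology.IsBounded D) :
    volume (frontier D) = 0 := by
  have hα := hD.alpha_pos
  have hae := Besicovitch.ae_tendsto_measure_inter_div
    (volume : Measure (EuclideanSpace ℝ (Fin n))) (frontier D)
  rw [← Measure.restrict_eq_zero, ← ae_eq_bot, ← Filter.eventually_false_iff_eq_bot]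
  filter_upwards [hae, ae_restrict_mem isClosed_frontier.measurableSet] with ξ hlim hξ
  obtain ⟨η, hη⟩ : ∃ η, η = α / 4 := ⟨_, rfl⟩
  have hη0 : 0 < η := by rw [hη]; positivity
  obtain ⟨θ, hθ⟩ : ∃ θ, θ = (η / (1 + η)) ^ n := ⟨_, rfl⟩
  have hθ0 : 0 < θ := by rw [hθ]; positivity
  have hlt : (1 : ℝ≥0∞) - ENNReal.ofReal θ < 1 :=
    ENNReal.sub_lt_self ENNReal.one_ne_top one_ne_zero (by simpa using hθ0)
  have hev := hlim.eventually_const_lt hlt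
  rw [eventually_nhdsWithin_iff, Metric.eventually_nhds_iff] at hev
  obtain ⟨ε, hε, hev⟩ := hev
  obtain ⟨y, hy, hyd, hyb⟩ := porous hn hD hb hξ (r₀ := ε / (2 * (1 + η))) (by positivity)
  rw [← hη] at hyb
  have hd0 : 0 < dist y ξ := dist_pos.2 fun h => by
    rw [hD.isOpen.frontier_eq] at hξ
    exact hξ.2 (h ▸ hy)
  obtain ⟨ρ, hρ⟩ : ∃ ρ, ρ = (1 + η) * dist y ξ := ⟨_, rfl⟩
  have hρ0 : 0 < ρ := by rw [hρ]; positivity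
  have hρε : ρ < ε := by
    have := mul_le_mul_of_nonneg_left hyd (show 0 ≤ 1 + η by positivity)
    have e : (1 + η) * (ε / (2 * (1 + η))) = ε / 2 := by field_simp
    linarith
  have h1 := hev (y := ρ) (by simpa [abs_of_pos hρ0] using hρε) hρ0
  refine absurd h1 (not_lt.2 ?_)
  have hsub : ball y (η * dist y ξ) ⊆ closedBall ξ ρ \ frontier D := by
    intro z hz
    refine ⟨?_, fun hzf => ?_⟩
    · have := dist_triangle z y ξ
      rw [mem_ball] at hz
      rw [mem_closedBall, hρ]
      linarith
    · exact Set.disjoint_left.1 (ball_disjoint (D := D) y) (ball_subset_ball hyb.le hz) hzf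
  have hfr : Module.finrank ℝ (EuclideanSpace ℝ (Fin n)) = n := by simp
  have hvol : volume (ball y (η * dist y ξ)) = ENNReal.ofReal θ * volume (closedBall ξ ρ) := by
    rw [Measure.addHaar_ball_of_pos _ _ (by positivity), Measure.addHaar_closedBall _ _ hρ0.le, hfr,
      ← mul_assoc, ← ENNReal.ofReal_mul hθ0.le]
    congr 2
    rw [hθ, hρ, ← mul_pow]
    congr 1
    field_simp
  have hcb0 : volume (closedBall ξ ρ) ≠ 0 := (measure_closedBall_pos _ _ hρ0).ne'
  have hcbt : volume (closedBall ξ ρ) ≠ ∞ := measure_closedBall_lt_top.ne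
  have hadd : volume (frontier D ∩ closedBall ξ ρ) + ENNReal.ofReal θ * volume (closedBall ξ ρ) ≤
      volume (closedBall ξ ρ) := by
    rw [← hvol]
    calc _ ≤ volume (closedBall ξ ρ ∩ frontier D) + volume (closedBall ξ ρ \ frontier D) := by
          rw [inter_comm]
          gcongr
      _ = _ := measure_inter_add_sdiff _ isClosed_frontier.measurableSet
  refine ENNReal.le_sub_of_add_le_right ENNReal.ofReal_ne_top ?_
  rw [← ENNReal.mul_le_mul_iff_left hcb0 hcbt, add_mul, ENNReal.div_mul_cancel hcb0 hcbt, one_mul]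
  exact hadd

/-- Coordinate along `v`. -/
noncomputable def coordAlong {n : ℕ} (v z : EuclideanSpace ℝ (Fin n)) : ℝ :=
  inner ℝ v z / ‖v‖ ^ 2

lemma coordAlong_line {n : ℕ} {v w : EuclideanSpace ℝ (Fin n)} (hv : v ≠ 0)
    (hw : w ∈ (Submodule.span ℝ {v})ᗮ) (t : ℝ) : coordAlong v (w + t • v) = t := by
  have h0 : inner ℝ v w = 0 := Submodule.mem_orthogonal_singleton_iff_inner_right.1 hw
  have : ‖v‖ ≠ 0 := norm_ne_zero_iff.2 hv
  unfold coordAlong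
  rw [inner_add_right, h0, inner_smul_right, real_inner_self_eq_norm_sq]
  field_simp
  ring

lemma coordAlong_lip {n : ℕ} {v : EuclideanSpace ℝ (Fin n)} (hv : v ≠ 0)
    (a b : EuclideanSpace ℝ (Fin n)) : |coordAlong v a - coordAlong v b| ≤ dist a b / ‖v‖ := by
  have hv0 : 0 < ‖v‖ := norm_pos_iff.2 hv
  unfold coordAlong
  rw [← sub_div, ← inner_sub_right, abs_div, abs_of_pos (by positivity : 0 < ‖v‖ ^ 2),
    div_le_div_iff₀ (by positivity) hv0, dist_eq_norm]
  have := abs_real_inner_le_norm v (a - b)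
  nlinarith

lemma coordAlong_cont {n : ℕ} (v : EuclideanSpace ℝ (Fin n)) : Continuous (coordAlong v) := by
  unfold coordAlong
  fun_prop

lemma line_cover {n : ℕ} {Ω : ℕ → Set (EuclideanSpace ℝ (Fin n))}
    {x v w : EuclideanSpace ℝ (Fin n)} {r : ℝ} (hv : v ≠ 0)
    (hw : w ∈ (Submodule.span ℝ {v})ᗮ)
    (hdet : HasDetourProperty Ω (closedBall x r) (lineThrough w v))
    {t : ℝ} (ht : w + t • v ∈ ball x r) (hz : ∀ k, w + t • v ∉ closure (Ω k)) (N : ℕ) :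
    ∃ k, N < k ∧ (lineThrough w v ∩ closure (Ω k)).Nonempty ∧
      ∃ y ∈ closure (Ω k), coordAlong v y = t := by
  have hv0 : 0 < ‖v‖ := norm_pos_iff.2 hv
  obtain ⟨z, hzdef⟩ : ∃ z, z = w + t • v := ⟨_, rfl⟩
  rw [← hzdef] at ht hz
  have hclosed : IsClosed (⋃ k ∈ Finset.range (N + 1), closure (Ω k)) :=
    isClosed_biUnion_finset fun k _ => isClosed_closure
  obtain ⟨ε₁, hε₁, hball⟩ := Metric.isOpen_iff.1 hclosed.isOpen_compl z (by
    simp only [mem_compl_iff, mem_iUnion, not_exists]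
    exact fun k _ => hz k)
  rw [mem_ball] at ht
  obtain ⟨τ, hτ⟩ : ∃ τ, τ = (r - dist z x) / (2 * ‖v‖) := ⟨_, rfl⟩
  have hτ0 : 0 < τ := by rw [hτ]; exact div_pos (by linarith) (by positivity)
  have hτv : τ * ‖v‖ = (r - dist z x) / 2 := by rw [hτ]; field_simp
  obtain ⟨ε, hε⟩ : ∃ ε, ε = min (ε₁ / 4) (τ * ‖v‖ / 2) := ⟨_, rfl⟩
  have hε0 : 0 < ε := by rw [hε]; exact lt_min (by positivity) (by positivity)
  have hεa : ε ≤ ε₁ / 4 := by rw [hε]; exact min_le_left _ _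
  have hεb : ε ≤ τ * ‖v‖ / 2 := by rw [hε]; exact min_le_right _ _
  have hmem : ∀ σ : ℝ, |σ| ≤ τ → w + (t + σ) • v ∈ lineThrough w v ∩ closedBall x r := by
    intro σ hσ
    refine ⟨⟨t + σ, rfl⟩, ?_⟩
    rw [mem_closedBall]
    have e : dist (w + (t + σ) • v) z = |σ| * ‖v‖ := by
      rw [hzdef, dist_eq_norm, show w + (t + σ) • v - (w + t • v) = σ • v by module, norm_smul,
        Real.norm_eq_abs]
    have h1 := dist_triangle (w + (t + σ) • v) z x
    have h2 := mul_le_mul_of_nonneg_right hσ hv0.le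
    linarith
  obtain ⟨γ, hγ, hH, hsub, -, hiii⟩ := hdet ε hε0
  have hfin : hausdorffEDist (γ '' Icc 0 1) (lineThrough w v ∩ closedBall x r) ≠ ⊤ := by
    refine hausdorffEDist_ne_top_of_nonempty_of_bounded ?_ ⟨_, hmem 0 (by simpa using hτ0.le)⟩ ?_ ?_
    · exact (nonempty_Icc.2 zero_le_one).image _
    · exact (isCompact_Icc.image_of_continuousOn hγ).isBounded
    · exact isBounded_closedBall.subset inter_subset_right
  have hH2 : hausdorffDist (γ '' Icc 0 1) (lineThrough w v ∩ closedBall x r) < 2 * ε := by linarith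
  have h2ε : 2 * ε / ‖v‖ ≤ τ := by
    rw [div_le_iff₀ hv0]; linarith
  have hnear : ∀ σ : ℝ, |σ| ≤ τ → ∃ a ∈ γ '' Icc 0 1, |coordAlong v a - (t + σ)| < τ := by
    intro σ hσ
    obtain ⟨a, ha, hd⟩ := exists_dist_lt_of_hausdorffDist_lt' (hmem σ hσ) hH2 hfin
    refine ⟨a, ha, ?_⟩
    have h1 := coordAlong_lip hv a (w + (t + σ) • v)
    rw [coordAlong_line hv hw] at h1
    exact (h1.trans_lt ((div_lt_div_iff_of_pos_right hv0).2 hd)).trans_le h2ε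
  obtain ⟨a, ha, hat⟩ := hnear (-τ) (by rw [abs_neg, abs_of_pos hτ0])
  obtain ⟨b, hb, hbt⟩ := hnear τ (by rw [abs_of_pos hτ0])
  rw [abs_lt] at hat hbt
  have hpre : IsPreconnected (coordAlong v '' (γ '' Icc 0 1)) :=
    (isPreconnected_Icc.image γ hγ).image _ (coordAlong_cont v).continuousOn
  obtain ⟨y, hy, hyt⟩ := hpre.Icc_subset (mem_image_of_mem _ ha) (mem_image_of_mem _ hb)
    (show t ∈ Icc _ _ from ⟨by linarith, by linarith⟩)
  obtain ⟨q, ⟨⟨t', rfl⟩, -⟩, hyq⟩ := exists_dist_lt_of_hausdorffDist_lt hy hH2 hfin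
  have hyz : dist y z < ε₁ := by
    have h1 := coordAlong_lip hv y (w + t' • v)
    rw [coordAlong_line hv hw, hyt, le_div_iff₀ hv0] at h1
    have e : dist (w + t' • v) z = |t - t'| * ‖v‖ := by
      rw [hzdef, dist_comm, dist_eq_norm, show w + t • v - (w + t' • v) = (t - t') • v by module,
        norm_smul, Real.norm_eq_abs]
    have h3 := dist_triangle y (w + t' • v) z
    linarith
  obtain ⟨k, hk⟩ := mem_iUnion.1 (hsub hy)
  refine ⟨k, ?_, hiii ⟨y, hy, hk⟩, y, hk, hyt⟩
  by_contra hkN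
  refine hball hyz ?_
  simp only [mem_iUnion]
  exact ⟨k, Finset.mem_range.2 (by omega), hk⟩

lemma fubini_line {n : ℕ} {v : EuclideanSpace ℝ (Fin n)} (hv : v ≠ 0)
    {F : Set (EuclideanSpace ℝ (Fin n))} (hF : MeasurableSet F)
    (h : ∀ᵐ w : ↥(Submodule.span ℝ {v})ᗮ,
      volume {t : ℝ | (w : EuclideanSpace ℝ (Fin n)) + t • v ∈ F} = 0) : volume F = 0 := by
  let W := (Submodule.span ℝ {v})ᗮ
  let f : (W × ℝ) →ₗ[ℝ] EuclideanSpace ℝ (Fin n) :=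
    W.subtype.coprod (LinearMap.toSpanSingleton ℝ _ v)
  have hf : ∀ w : W, ∀ t : ℝ, f (w, t) = (w : EuclideanSpace ℝ (Fin n)) + t • v := by
    intro w t
    simp [f]
  have hinj : Function.Injective f := by
    rw [injective_iff_map_eq_zero]
    rintro ⟨w, t⟩ h0
    rw [hf] at h0
    have ht : t = 0 := by
      rw [← coordAlong_line hv w.2 t, h0]
      simp [coordAlong]
    subst ht
    simp only [zero_smul, add_zero] at h0
    ext1
    · exact Subtype.ext h0
    · rfl
  have hsurj : Function.Surjective f := by
    intro z
    refine ⟨(⟨z - coordAlong v z • v, ?_⟩, coordAlong v z), ?_⟩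
    · have : ‖v‖ ≠ 0 := norm_ne_zero_iff.2 hv
      rw [Submodule.mem_orthogonal_singleton_iff_inner_right, inner_sub_right, inner_smul_right,
        real_inner_self_eq_norm_sq]
      unfold coordAlong
      field_simp
      ring
    · rw [hf]; simp
  let e : (W × ℝ) ≃L[ℝ] EuclideanSpace ℝ (Fin n) :=
    (LinearEquiv.ofBijective f ⟨hinj, hsurj⟩).toContinuousLinearEquiv
  have he : ∀ p : W × ℝ, e p = (p.1 : EuclideanSpace ℝ (Fin n)) + p.2 • v := fun p => hf p.1 p.2
  let μ : Measure (W × ℝ) := (volume : Measure W).prod (volume : Measure ℝ)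
  have hμ : (μ.map e).IsAddHaarMeasure := e.isAddHaarMeasure_map μ
  have hac : (volume : Measure (EuclideanSpace ℝ (Fin n))) ≪ μ.map e :=
    Measure.absolutelyContinuous_isAddHaarMeasure _ _
  apply hac
  rw [Measure.map_apply e.continuous.measurable hF]
  rw [Measure.measure_prod_null (e.continuous.measurable hF)]
  filter_upwards [h] with w hw
  have hw2 : volume {t : ℝ | (w : EuclideanSpace ℝ (Fin n)) + t • v ∈ F} = 0 := hw
  simpa [Set.preimage, he] using hw2

lemma residual_null {n : ℕ} (hn : n ≠ 0) {K : Set (EuclideanSpace ℝ (Fin n))}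
    {Ω : ℕ → Set (EuclideanSpace ℝ (Fin n))} {x v : EuclideanSpace ℝ (Fin n)} {r : ℝ}
    (hKc : IsClosed K) (hK : K ⊆ ball x r) (hv : v ≠ 0)
    (hdet : ∀ᵐ w : ↥(Submodule.span ℝ {v})ᗮ,
        HasDetourProperty Ω (closedBall x r) (lineThrough (w : EuclideanSpace ℝ (Fin n)) v))
    (xs : ℕ → EuclideanSpace ℝ (Fin n)) (ρ : ℕ → ℝ) (hρ : ∀ k, 0 ≤ ρ k)
    (hcl : ∀ k, closure (Ω (k + 1)) ⊆ closedBall (xs k) (ρ k))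
    (hsum : ∑' k, ENNReal.ofReal (ρ k ^ n) ≠ ∞) :
    volume (K \ ⋃ k, closure (Ω k)) = 0 := by
  have hv0 : 0 < ‖v‖ := norm_pos_iff.2 hv
  let W := (Submodule.span ℝ {v})ᗮ
  have hfr : Module.finrank ℝ W = n - 1 := by
    obtain ⟨m, rfl⟩ := Nat.exists_eq_succ_of_ne_zero hn
    have : Fact (Module.finrank ℝ (EuclideanSpace ℝ (Fin (m + 1))) = m + 1) := ⟨by simp⟩
    exact Submodule.finrank_orthogonal_span_singleton (n := m) hv
  let P : EuclideanSpace ℝ (Fin n) →L[ℝ] W := W.orthogonalProjectionOnto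
  let S : ℕ → Set W := fun k => closedBall (P (xs k)) (ρ k)
  let g : ℕ → W → ℝ≥0∞ := fun k => (S k).indicator fun _ => ENNReal.ofReal (2 * (ρ k / ‖v‖))
  have hgm : ∀ k, Measurable (g k) := fun k =>
    measurable_const.indicator measurableSet_closedBall
  have hint : ∫⁻ w, ∑' k, g k w ≠ ∞ := by
    rw [lintegral_tsum fun k => (hgm k).aemeasurable]
    have e : ∀ k, ∫⁻ w, g k w ≤
        (ENNReal.ofReal (2 / ‖v‖) * volume (closedBall (0 : W) 1)) * ENNReal.ofReal (ρ k ^ n) := by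
      intro k
      have e0 : ∫⁻ w, g k w = ENNReal.ofReal (2 * (ρ k / ‖v‖)) *
          volume (closedBall (P (xs k)) (ρ k)) :=
        lintegral_indicator_const measurableSet_closedBall _
      rw [e0, Measure.addHaar_closedBall' _ _ (hρ k), hfr]
      have e1 : ρ k ^ n = ρ k * ρ k ^ (n - 1) := by
        rw [← pow_succ', Nat.sub_add_cancel (Nat.pos_of_ne_zero hn)]
      rw [e1, ENNReal.ofReal_mul (hρ k), show 2 * (ρ k / ‖v‖) = 2 / ‖v‖ * ρ k by ring,
        ENNReal.ofReal_mul (by positivity)]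
      apply le_of_eq
      ring
    refine ne_top_of_le_ne_top ?_ (ENNReal.tsum_le_tsum e)
    rw [ENNReal.tsum_mul_left]
    exact ENNReal.mul_ne_top (ENNReal.mul_ne_top ENNReal.ofReal_ne_top
      measure_closedBall_lt_top.ne) hsum
  have hae := ae_lt_top (Measurable.tsum hgm) hint
  refine fubini_line hv (hKc.measurableSet.diff
    (MeasurableSet.iUnion fun k => isClosed_closure.measurableSet)) ?_
  filter_upwards [hdet, hae] with w hw hfin
  classical
  let A : ℕ → Set ℝ := fun k =>
    if w ∈ S k then closedBall (coordAlong v (xs k)) (ρ k / ‖v‖) else ∅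
  have hA : ∀ k, volume (A k) = g k w := by
    intro k
    by_cases h : w ∈ S k
    · simp only [A, g, if_pos h, indicator_of_mem h, Real.volume_closedBall]
    · simp only [A, g, if_neg h, indicator_of_notMem h, measure_empty]
  have hlim : volume (limsup A atTop) = 0 := by
    refine measure_limsup_atTop_eq_zero ?_
    simp only [hA]
    exact hfin.ne
  refine measure_mono_null ?_ hlim
  rintro t ⟨htK, htn⟩
  rw [mem_limsup_iff_frequently_mem, frequently_atTop]
  intro N
  obtain ⟨k, hNk, ⟨q, ⟨t', rfl⟩, hq⟩, y, hy, hyt⟩ := line_cover hv w.2 hw (hK htK)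
    (fun k hk => htn (mem_iUnion.2 ⟨k, hk⟩)) N
  obtain ⟨j, rfl⟩ : ∃ j, k = j + 1 := ⟨k - 1, by omega⟩
  refine ⟨j, by omega, ?_⟩
  have hwS : w ∈ S j := by
    have h1 := hcl j hq
    have hPw : P ((w : EuclideanSpace ℝ (Fin n)) + t' • v) = w := by
      have h2 : P v = 0 := Submodule.orthogonalProjectionOnto_orthogonalComplement_singleton_eq_zero v
      rw [map_add, map_smul, h2, smul_zero, add_zero]
      exact Submodule.orthogonalProjectionOnto_mem_subspace_eq_self w
    simp only [S, mem_closedBall] at h1 ⊢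
    rw [← hPw, dist_eq_norm, ← map_sub]
    refine (W.norm_orthogonalProjectionOnto_apply_le _).trans ?_
    rwa [dist_eq_norm] at h1
  simp only [A, if_pos hwS]
  rw [mem_closedBall, Real.dist_eq, ← hyt]
  refine (coordAlong_lip hv _ _).trans ?_
  have := hcl j hy
  rw [mem_closedBall] at this
  gcongr

lemma ball_subset_domain {n : ℕ} {D : Set (EuclideanSpace ℝ (Fin n))} (ho : IsOpen D)
    {y : EuclideanSpace ℝ (Fin n)} (hy : y ∈ D) (hpos : 0 < distBoundary D y) :
    ball y (distBoundary D y) ⊆ D := by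
  refine (convex_ball y _).isPreconnected.subset_of_closure_inter_subset ho
    ⟨y, mem_ball_self hpos, hy⟩ ?_
  rintro z ⟨hz, hzb⟩
  by_contra hzD
  refine Set.disjoint_left.1 (ball_disjoint (D := D) y) hzb ?_
  rw [ho.frontier_eq]
  exact ⟨hz, hzD⟩

lemma component_subset_ball {n : ℕ} {K : Set (EuclideanSpace ℝ (Fin n))}
    {x z : EuclideanSpace ℝ (Fin n)} {r : ℝ} (hr : 0 < r) (hK : K ⊆ ball x r)
    (hb : Bornology.IsBounded (connectedComponentIn Kᶜ z)) :
    connectedComponentIn Kᶜ z ⊆ ball x r := by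
  intro y hy
  by_contra hyb
  rw [mem_ball, not_lt, dist_eq_norm] at hyb
  rw [connectedComponentIn_eq hy] at hb
  have hpre : IsPreconnected ((fun t : ℝ => x + t • (y - x)) '' Ici 1) :=
    isPreconnected_Ici.image _ (by fun_prop)
  have hsub := hpre.subset_connectedComponentIn (x := y) (F := Kᶜ) ⟨1, by simp, by simp⟩ (by
    rintro _ ⟨t, ht, rfl⟩ htK
    have h1 := hK htK
    rw [mem_ball, dist_eq_norm, add_sub_cancel_left, norm_smul, Real.norm_eq_abs] at h1
    have ht1 : (1 : ℝ) ≤ t := ht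
    rw [abs_of_nonneg (by linarith)] at h1
    nlinarith)
  obtain ⟨M, hM⟩ := hb.subset_closedBall x
  have h2 := hM (hsub ⟨max 1 ((M + 1) / r), mem_Ici.2 (le_max_left _ _), rfl⟩)
  rw [mem_closedBall, dist_eq_norm, add_sub_cancel_left, norm_smul, Real.norm_eq_abs,
    abs_of_nonneg (le_trans zero_le_one (le_max_left _ _))] at h2
  have h3 : (M + 1) / r ≤ max 1 ((M + 1) / r) := le_max_right _ _
  rw [div_le_iff₀ hr] at h3
  have h4 := mul_le_mul_of_nonneg_left hyb
    (le_trans zero_le_one (le_max_left 1 ((M + 1) / r)))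
  linarith

theorem statement14 (n : ℕ) (K : Set (EuclideanSpace ℝ (Fin n)))
    (Ω : ℕ → Set (EuclideanSpace ℝ (Fin n))) (hK : IsHolderDetourSet n K Ω) :
    volume K = 0 ∧ Tendsto (fun k => EMetric.diam (Ω k)) atTop (𝓝 0) := by
  obtain ⟨hdet, α, c, hhol, R, hR, x₀, h0⟩ := hK
  have hn : n ≠ 0 := by
    rintro rfl
    exact hdet.unbounded (Set.toFinite _).isBounded
  have hKo : IsOpen Kᶜ := hdet.compact.isClosed.isOpen_compl
  have hopen : ∀ k, IsOpen (Ω k) := by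
    intro k
    obtain ⟨z, -, hz⟩ := hdet.component k
    rw [hz]
    exact hKo.connectedComponentIn
  have hsubK : ∀ k, Ω k ⊆ Kᶜ := by
    intro k
    obtain ⟨z, -, hz⟩ := hdet.component k
    rw [hz]
    exact connectedComponentIn_subset _ _
  have hdisj : Pairwise (Function.onFun Disjoint Ω) := by
    intro j k hjk
    rw [Function.onFun, Set.disjoint_left]
    intro z hj hk
    obtain ⟨a, -, ha⟩ := hdet.component j
    obtain ⟨b, -, hb⟩ := hdet.component k
    apply hjk
    apply hdet.inj
    rw [ha] at hj
    rw [hb] at hk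
    rw [ha, hb, connectedComponentIn_eq hj, connectedComponentIn_eq hk]
  obtain ⟨x, r, hr, hKr, v, hvli, hline⟩ := hdet.detour
  have hinball : ∀ k, Ω (k + 1) ⊆ ball x r := by
    intro k
    have hb := hdet.bounded (k + 1) (by omega)
    obtain ⟨z, -, hz⟩ := hdet.component (k + 1)
    rw [hz] at hb ⊢
    exact component_subset_ball hr hKr hb
  have hα := h0.alpha_pos
  choose xs hxs using fun k : ℕ => hhol (k + 1) (by omega)
  have hbk : ∀ k : ℕ, Bornology.IsBounded (Ω (k + 1)) := fun k => hdet.bounded (k + 1) (by omega)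
  let δ : ℕ → ℝ := fun k => distBoundary (Ω (k + 1)) (xs k)
  have hδ : ∀ k, 0 < δ k := fun k =>
    distBoundary_pos hn (hopen _) (hbk k) (hxs k).basepoint_mem
  obtain ⟨C, hC⟩ : ∃ C, C = 4 * Real.exp (α * c) / α := ⟨_, rfl⟩
  have hC0 : 0 < C := by rw [hC]; positivity
  let ρ : ℕ → ℝ := fun k => C * δ k
  have hρ : ∀ k, 0 ≤ ρ k := fun k => (mul_pos hC0 (hδ k)).le
  have hcl : ∀ k, closure (Ω (k + 1)) ⊆ closedBall (xs k) (ρ k) := by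
    intro k
    refine closure_minimal (fun y hy => ?_) isClosed_closedBall
    have := holder_dist hn (hxs k) (hbk k) hy
    rw [← hC] at this
    exact this
  have hvolsum : ∑' k, volume (Ω (k + 1)) ≠ ∞ := by
    rw [← measure_iUnion (f := fun k => Ω (k + 1)) (fun i j hij => hdisj (by omega)) (fun k => (hopen _).measurableSet)]
    exact ne_top_of_le_ne_top measure_ball_lt_top.ne (measure_mono (iUnion_subset hinball))
  have hV0 : volume (ball (0 : EuclideanSpace ℝ (Fin n)) 1) ≠ 0 :=
    (measure_ball_pos _ _ one_pos).ne'
  have hVt : volume (ball (0 : EuclideanSpace ℝ (Fin n)) 1) ≠ ∞ := measure_ball_lt_top.ne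
  have hsum : ∑' k, ENNReal.ofReal (ρ k ^ n) ≠ ∞ := by
    have e : ∀ k, ENNReal.ofReal (ρ k ^ n) ≤ (ENNReal.ofReal (C ^ n) *
        (volume (ball (0 : EuclideanSpace ℝ (Fin n)) 1))⁻¹) * volume (Ω (k + 1)) := by
      intro k
      have h1 : volume (ball (xs k) (δ k)) ≤ volume (Ω (k + 1)) :=
        measure_mono (ball_subset_domain (hopen _) (hxs k).basepoint_mem (hδ k))
      rw [Measure.addHaar_ball_of_pos _ _ (hδ k), finrank_euclideanSpace_fin] at h1
      have h2 : ENNReal.ofReal (δ k ^ n) ≤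
          (volume (ball (0 : EuclideanSpace ℝ (Fin n)) 1))⁻¹ * volume (Ω (k + 1)) := by
        rw [mul_comm, ← div_eq_mul_inv]
        exact (ENNReal.le_div_iff_mul_le (Or.inl hV0) (Or.inl hVt)).2 h1
      simp only [ρ]
      rw [mul_pow, ENNReal.ofReal_mul (by positivity), mul_assoc]
      gcongr
    refine ne_top_of_le_ne_top ?_ (ENNReal.tsum_le_tsum e)
    rw [ENNReal.tsum_mul_left]
    exact ENNReal.mul_ne_top (ENNReal.mul_ne_top ENNReal.ofReal_ne_top
      (ENNReal.inv_ne_top.2 hV0)) hvolsum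
  constructor
  · have hres := residual_null hn hdet.compact.isClosed hKr
      (hvli.ne_zero ⟨0, Nat.pos_of_ne_zero hn⟩) (hline _) xs ρ hρ hcl hsum
    have hfront : ∀ k, volume (frontier (Ω k)) = 0 := by
      intro k
      rcases k with _ | k
      · refine measure_mono_null ?_ (frontier_null hn h0 (isBounded_ball.subset inter_subset_right))
        intro z hz
        rw [h0.isOpen.frontier_eq]
        have hzR := hR hz
        rw [(hopen 0).frontier_eq] at hz
        refine ⟨?_, fun h => hz.2 h.1⟩
        have := isOpen_ball.inter_closure (s := ball (0 : EuclideanSpace ℝ (Fin n)) R) ⟨hzR, hz.1⟩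
        rwa [inter_comm] at this
      · exact frontier_null hn (hxs k) (hbk k)
    refine measure_mono_null ?_ (measure_union_null hres (measure_iUnion_null hfront))
    intro z hz
    by_cases h : z ∈ ⋃ k, closure (Ω k)
    · right
      obtain ⟨k, hk⟩ := mem_iUnion.1 h
      refine mem_iUnion.2 ⟨k, ?_⟩
      rw [(hopen k).frontier_eq]
      exact ⟨hk, fun h => hsubK k h hz⟩
    · exact Or.inl ⟨hz, h⟩
  · rw [← tendsto_add_atTop_iff_nat 1]
    have ht := ENNReal.tendsto_atTop_zero_of_tsum_ne_top hsum
    have ht2 : Tendsto (fun k => ENNReal.ofReal (ρ k)) atTop (𝓝 0) := by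
      have h := (ENNReal.continuous_rpow_const (y := (n : ℝ)⁻¹)).tendsto 0 |>.comp ht
      rw [ENNReal.zero_rpow_of_pos (by positivity)] at h
      refine h.congr fun k => ?_
      simp only [Function.comp]
      rw [ENNReal.ofReal_pow (hρ k), ENNReal.pow_rpow_inv_natCast hn]
    have ht3 : Tendsto (fun k => 2 * ENNReal.ofReal (ρ k)) atTop (𝓝 0) := by
      simpa using ENNReal.Tendsto.const_mul ht2 (Or.inr (by norm_num : (2 : ℝ≥0∞) ≠ ∞))
    refine tendsto_of_tendsto_of_tendsto_of_le_of_le tendsto_const_nhds ht3 (fun _ => zero_le)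
      fun k => ?_
    have h1 : Metric.ediam (Ω (k + 1)) ≤ Metric.ediam (closedBall (xs k) (ρ k)) :=
      Metric.ediam_mono (subset_closure.trans (hcl k))
    refine h1.trans ?_
    refine Metric.ediam_le fun a ha b hb => ?_
    rw [edist_dist, two_mul, ← ENNReal.ofReal_add (hρ k) (hρ k)]
    apply ENNReal.ofReal_le_ofReal
    have h2 := dist_triangle_right a b (xs k)
    rw [mem_closedBall] at ha hb
    linarith
end

section
/- Let Ω ⊆ V ⊆ ℝ² be bounded Jordan regions with cl(Ω) ⊆ cl(V). If ∂Ω ∩ ∂V contains at least two points, then each connected component of V ∖ cl(Ω) is a Jordan region whose boundary intersects both ∂Ω and ∂V. If ∂Ω ∩ ∂V contains exactly one point, then V ∖ cl(Ω) is not a Jordan region. -/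
open MeasureTheory Metric Set Filter
open scoped ENNReal NNReal Topology

/-- A Jordan curve in the plane: the homeomorphic (equivalently, continuous injective) image
of a circle. -/
def IsJordanCurve (J : Set (EuclideanSpace ℝ (Fin 2))) : Prop :=
  ∃ f : Metric.sphere (0 : EuclideanSpace ℝ (Fin 2)) 1 → EuclideanSpace ℝ (Fin 2),
    Continuous f ∧ Function.Injective f ∧ Set.range f = J

/-- A Jordan region: an open subset of the plane whose boundary is a Jordan curve. -/
def IsJordanRegion (Ω : Set (EuclideanSpace ℝ (Fin 2))) : Prop :=
  IsOpen Ω ∧ IsJordanCurve (frontier Ω)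

/-- An unbounded Jordan region: `∂Ω` is a Jordan curve and `Ω` is the unbounded connected
component of the complement of `∂Ω`. -/
def IsUnboundedJordanRegion (Ω : Set (EuclideanSpace ℝ (Fin 2))) : Prop :=
  IsJordanCurve (frontier Ω) ∧ ¬ Bornology.IsBounded Ω ∧
    ∃ x ∈ Ω, Ω = connectedComponentIn (frontier Ω)ᶜ x

/-- `K` does not separate `a` and `b`. -/
def NotSep {X : Type*} [TopologicalSpace X] (K : Set X) (a b : X) : Prop :=
  ∃ S : Set X, IsPreconnected S ∧ a ∈ S ∧ b ∈ S ∧ Disjoint S K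

def HasLog (K : Set ℂ) (a b : ℂ) : Prop :=
  ∃ g : ℂ → ℂ, ContinuousOn g K ∧ ∀ z ∈ K, Complex.exp (g z) = (z - a) / (z - b)

lemma HasLog.symm {K : Set ℂ} {a b : ℂ} (h : HasLog K a b) : HasLog K b a := by
  obtain ⟨g, hg, h⟩ := h
  refine ⟨fun z => - g z, hg.neg, fun z hz => ?_⟩
  rw [Complex.exp_neg, h z hz, inv_div]

lemma HasLog.trans {K : Set ℂ} {a b c : ℂ} (hb : b ∉ K) (h : HasLog K a b) (h' : HasLog K b c) :
    HasLog K a c := by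
  obtain ⟨g, hg, h⟩ := h
  obtain ⟨g', hg', h'⟩ := h'
  refine ⟨fun z => g z + g' z, hg.add hg', fun z hz => ?_⟩
  have : z - b ≠ 0 := sub_ne_zero.2 (fun e => hb (e ▸ hz))
  rw [Complex.exp_add, h z hz, h' z hz, div_mul_div_cancel₀ this]

lemma hasLog_near {K : Set ℂ} (hK : IsClosed K) {a : ℂ} (ha : a ∉ K) :
    ∃ r > 0, ∀ b ∈ ball a r, b ∉ K ∧ HasLog K a b := by
  obtain ⟨r, hr, hb⟩ := Metric.isOpen_iff.1 hK.isOpen_compl a ha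
  refine ⟨r / 2, by positivity, fun b hbb => ?_⟩
  have hbK : b ∉ K := hb (ball_subset_ball (by linarith) hbb)
  have key : ∀ z ∈ K, (z - b) ≠ 0 ∧ ‖(z - a) / (z - b) - 1‖ < 1 := by
    intro z hz
    have h0 : z - b ≠ 0 := sub_ne_zero.2 (fun e => hbK (e ▸ hz))
    refine ⟨h0, ?_⟩
    have h1 : (z - a) / (z - b) - 1 = (b - a) / (z - b) := by field_simp; ring
    rw [h1, norm_div, div_lt_one (norm_pos_iff.2 h0)]
    have h2 : r ≤ ‖z - a‖ := by
      by_contra hlt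
      exact hb (show z ∈ ball a r by simpa [dist_eq_norm] using hlt) hz
    have h3 : ‖b - a‖ < r / 2 := by simpa [dist_eq_norm] using hbb
    have h4 : ‖z - a‖ ≤ ‖z - b‖ + ‖b - a‖ := by
      simpa using norm_add_le (z - b) (b - a)
    linarith
  refine ⟨hbK, fun z => Complex.log ((z - a) / (z - b)), ?_, ?_⟩
  · apply ContinuousOn.clog
    · exact ContinuousOn.div (by fun_prop) (by fun_prop) (fun z hz => (key z hz).1)
    · intro z hz
      have := (key z hz).2
      apply Complex.mem_slitPlane_of_norm_lt_one (z := (z - a) / (z - b) - 1) at this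
      simpa using this
  · intro z hz
    refine Complex.exp_log ?_
    intro h
    have := (key z hz).2
    rw [h] at this
    simp at this

lemma hasLog_of_notSep {K : Set ℂ} (hK : IsClosed K) {a b : ℂ} (h : NotSep K a b) :
    HasLog K a b := by
  obtain ⟨S, hS, haS, hbS, hd⟩ := h
  have hSK : ∀ z ∈ S, z ∉ K := fun z hz hk => Set.disjoint_left.1 hd hz hk
  have hrefl : HasLog K a a := ⟨fun _ => 0, continuousOn_const, fun z hz => by
    have : z - a ≠ 0 := sub_ne_zero.2 (fun e => hSK a haS (e ▸ hz))
    simp [this]⟩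
  by_contra hcon
  let U : Set ℂ := {z | z ∉ K ∧ HasLog K a z}
  let V : Set ℂ := {z | z ∉ K ∧ ¬ HasLog K a z}
  have hU : IsOpen U := by
    rw [Metric.isOpen_iff]
    rintro z ⟨hz, hl⟩
    obtain ⟨r, hr, h⟩ := hasLog_near hK hz
    exact ⟨r, hr, fun w hw => ⟨(h w hw).1, hl.trans hz (h w hw).2⟩⟩
  have hV : IsOpen V := by
    rw [Metric.isOpen_iff]
    rintro z ⟨hz, hl⟩
    obtain ⟨r, hr, h⟩ := hasLog_near hK hz
    exact ⟨r, hr, fun w hw => ⟨(h w hw).1, fun hh => hl (hh.trans (h w hw).1 (h w hw).2.symm)⟩⟩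
  obtain ⟨z, hz, hzU, hzV⟩ := hS U V hU hV (fun z hz => by
    by_cases h : HasLog K a z
    · exact Or.inl ⟨hSK z hz, h⟩
    · exact Or.inr ⟨hSK z hz, h⟩) ⟨a, haS, hSK a haS, hrefl⟩ ⟨b, hbS, hSK b hbS, hcon⟩
  exact hzV.2 hzU.2

lemma exists_log {A : Type*} [TopologicalSpace A] [SimplyConnectedSpace A]
    [LocallyPathConnectedSpace A] (a₀ : A) (F : C(A, ℂ)) (hF : ∀ z, F z ≠ 0) :
    ∃ G : C(A, ℂ), ∀ z, Complex.exp (G z) = F z := by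
  obtain ⟨G, hG, -⟩ := Complex.isCoveringMapOn_exp.existsUnique_continuousMap_lifts F
    (a₀ := a₀) (e₀ := Complex.log (F a₀)) (Complex.exp_log (hF a₀)) (fun a => hF a)
  exact ⟨G, fun z => congrFun hG.2 z⟩

/-- a continuous function with values in `2πiℤ` on a preconnected set is constant -/
lemma const_of_exp_eq_one {X : Type*} [TopologicalSpace X] {s : Set X} (hs : IsPreconnected s)
    {g : X → ℂ} (hg : ContinuousOn g s) (h1 : ∀ x ∈ s, Complex.exp (g x) = 1)
    {x y : X} (hx : x ∈ s) (hy : y ∈ s) : g x = g y := by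
  have h2 : ∀ x ∈ s, ∃ n : ℤ, g x = n * (2 * Real.pi * Complex.I) := fun x hx =>
    Complex.exp_eq_one_iff.1 (h1 x hx)
  have hc : ContinuousOn (fun x => (g x).im / (2 * Real.pi)) s :=
    (Complex.continuous_im.comp_continuousOn hg).div_const _
  have him := (hs.image _ hc)
  have hval : ∀ x ∈ s, ∃ n : ℤ, (g x).im / (2 * Real.pi) = n := by
    intro x hx
    obtain ⟨n, hn⟩ := h2 x hx
    refine ⟨n, ?_⟩
    rw [hn]
    have : Real.pi ≠ 0 := Real.pi_ne_zero
    simp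
  have hsub : ((fun x => (g x).im / (2 * Real.pi)) '' s).Subsingleton := by
    by_contra hns
    rw [Set.not_subsingleton_iff] at hns
    obtain ⟨u, hu, v, hv, huv⟩ := hns.exists_lt
    have hoc := him.ordConnected.out hu hv
    obtain ⟨x, hx, rfl⟩ := hu
    obtain ⟨n, hn⟩ := hval x hx
    simp only at hn huv hoc
    rw [hn] at huv hoc
    obtain ⟨q, hq1, hq2⟩ := exists_between (lt_min huv (lt_add_one (n : ℝ)))
    obtain ⟨y, hy, hyq⟩ := hoc ⟨hq1.le, (hq2.trans_le (min_le_left _ _)).le⟩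
    obtain ⟨m, hm⟩ := hval y hy
    simp only at hyq
    rw [← hyq, hm] at hq1 hq2
    have a1 : n < m := by exact_mod_cast hq1
    have a2 : m < n + 1 := by exact_mod_cast hq2.trans_le (min_le_right _ _)
    omega
  have := hsub ⟨x, hx, rfl⟩ ⟨y, hy, rfl⟩
  simp only at this
  obtain ⟨n, hn⟩ := h2 x hx
  obtain ⟨m, hm⟩ := h2 y hy
  rw [hn, hm] at this ⊢
  have hp : Real.pi ≠ 0 := Real.pi_ne_zero
  simp at this
  rw [this]

lemma no_log_circle (a : ℂ) (R : ℝ) (hR : 0 < R) (G : C(ℂ, ℂ))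
    (h : ∀ z, ‖z - a‖ = R → Complex.exp (G z) = z - a) : False := by
  let c : ℝ → ℂ := fun t => a + R * Complex.exp (t * Complex.I)
  have hc : Continuous c := by fun_prop
  have hn : ∀ t, ‖c t - a‖ = R := fun t => by
    simp [c, Complex.norm_exp_ofReal_mul_I, abs_of_pos hR]
  have hR' : (R : ℂ) ≠ 0 := by exact_mod_cast hR.ne'
  have hconst := const_of_exp_eq_one (s := (Set.univ : Set ℝ)) isPreconnected_univ
    (g := fun t => G (c t) - (t * Complex.I + Real.log R)) (by fun_prop) (by
      intro t _
      rw [Complex.exp_sub, h _ (hn t), Complex.exp_add, ← Complex.ofReal_exp, Real.exp_log hR]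
      simp only [c, add_sub_cancel_left]
      rw [mul_comm, div_self (mul_ne_zero (Complex.exp_ne_zero _) hR')])
    (x := 0) (y := 2 * Real.pi) trivial trivial
  have hcc : c (2 * Real.pi) = c 0 := by
    simp [c, Complex.exp_two_pi_mul_I]
  simp only [hcc] at hconst
  have := congrArg Complex.im hconst
  simp at this
  linarith [Real.pi_pos]

lemma isPreconnected_norm_gt (R : ℝ) (hR : 0 < R) : IsPreconnected {z : ℂ | R < ‖z‖} := by
  have : {z : ℂ | R < ‖z‖} = Complex.exp '' {w | Real.log R < w.re} := by
    ext z
    constructor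
    · intro hz
      have hz : R < ‖z‖ := hz
      have h0 : z ≠ 0 := norm_pos_iff.1 (hR.trans hz)
      exact ⟨Complex.log z, by simpa [Complex.log_re] using Real.log_lt_log hR hz, Complex.exp_log h0⟩
    · rintro ⟨w, hw, rfl⟩
      have hw : Real.log R < w.re := hw
      simpa [Complex.norm_exp] using (Real.log_lt_iff_lt_exp hR).1 hw
  rw [this]
  exact (convex_halfSpace_re_gt _).isPreconnected.image _ Complex.continuous_exp.continuousOn

lemma frontier_comp_subset {X : Type*} [TopologicalSpace X] [LocallyConnectedSpace X]
    {D : Set X} (hD : IsOpen D) (x : X) :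
    Disjoint (frontier (connectedComponentIn D x)) D := by
  rw [Set.disjoint_left]
  intro y hy hyD
  have ho : IsOpen (connectedComponentIn D y) := hD.connectedComponentIn
  have hyy := mem_connectedComponentIn hyD
  obtain ⟨z, hz, hz'⟩ := mem_closure_iff.1 hy.1 _ ho hyy
  have h1 := connectedComponentIn_eq hz
  have h2 := connectedComponentIn_eq hz'
  rw [h2, ← h1] at hy
  rw [ho.frontier_eq] at hy
  exact hy.2 hyy

lemma notSep_of_hasLog_aux {K : Set ℂ} (hK : IsCompact K) {a b : ℂ} (ha : a ∉ K) (hbK : b ∉ K)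
    (h : HasLog K a b) (hB : Bornology.IsBounded (connectedComponentIn Kᶜ a)) :
    b ∈ connectedComponentIn Kᶜ a := by
  classical
  by_contra hb
  set U := connectedComponentIn Kᶜ a with hU
  have hUo : IsOpen U := hK.isClosed.isOpen_compl.connectedComponentIn
  have haU : a ∈ U := mem_connectedComponentIn ha
  have hfr : frontier U ⊆ K := fun z hz => by
    have := Set.disjoint_left.1 (frontier_comp_subset hK.isClosed.isOpen_compl a) hz
    simpa using this
  obtain ⟨g, hg, hgl⟩ := h
  obtain ⟨G, hG⟩ := ContinuousMap.exists_restrict_eq hK.isClosed ⟨K.domRestrict g, hg.domRestrict⟩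
  have hG' : ∀ z ∈ K, G z = g z := fun z hz => congrArg (fun f => f ⟨z, hz⟩) hG
  let F : ℂ → ℂ := U.piecewise (fun z => Complex.exp (G z) * (z - b)) (fun z => z - a)
  have hF : Continuous F := by
    apply continuous_piecewise
    · intro z hz
      have hzK := hfr hz
      rw [hG' z hzK, hgl z hzK]
      by_cases hzb : z = b
      · exfalso
        exact hbK (hzb ▸ hzK)
      · field_simp [sub_ne_zero.2 hzb]
    · fun_prop
    · fun_prop
  have hF0 : ∀ z, F z ≠ 0 := by
    intro z
    by_cases hz : z ∈ U
    · have : z ≠ b := fun e => hb (e ▸ hz)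
      simp [F, hz, sub_ne_zero.2 this]
    · have : z ≠ a := fun e => hz (e ▸ haU)
      simp [F, hz, sub_ne_zero.2 this]
  obtain ⟨L, hL⟩ := exists_log 0 ⟨F, hF⟩ hF0
  obtain ⟨R, hR, hUR⟩ := hB.subset_ball_lt 0 a
  refine no_log_circle a R hR L (fun z hz => ?_)
  rw [hL]
  have : z ∉ U := fun hzU => by
    have := hUR hzU
    simp [dist_eq_norm, hz] at this
  simp [F, this]

lemma notSep_of_hasLog {K : Set ℂ} (hK : IsCompact K) {a b : ℂ} (ha : a ∉ K) (hb : b ∉ K)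
    (h : HasLog K a b) : NotSep K a b := by
  have hmk : b ∈ connectedComponentIn Kᶜ a → NotSep K a b := fun hh =>
    ⟨_, isPreconnected_connectedComponentIn, mem_connectedComponentIn ha, hh,
      Set.disjoint_left.2 (fun z hz => connectedComponentIn_subset _ _ hz)⟩
  by_cases h1 : Bornology.IsBounded (connectedComponentIn Kᶜ a)
  · exact hmk (notSep_of_hasLog_aux hK ha hb h h1)
  by_cases h2 : Bornology.IsBounded (connectedComponentIn Kᶜ b)
  · have := notSep_of_hasLog_aux hK hb ha h.symm h2
    rw [← connectedComponentIn_eq this] at hmk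
    exact hmk (mem_connectedComponentIn hb)
  obtain ⟨R, hR, hKR⟩ := hK.isBounded.subset_closedBall_lt 0 0
  have hsub : {z : ℂ | R < ‖z‖} ⊆ Kᶜ := fun z hz hzK => by
    have := hKR hzK
    have hz : R < ‖z‖ := hz
    simp at this
    linarith
  have hcont : ∀ c, ¬ Bornology.IsBounded (connectedComponentIn Kᶜ c) →
      {z : ℂ | R < ‖z‖} ⊆ connectedComponentIn Kᶜ c := by
    intro c hc
    have : ∃ z ∈ connectedComponentIn Kᶜ c, R < ‖z‖ := by
      by_contra! hh
      exact hc ((isBounded_closedBall (x := (0:ℂ)) (r := R)).subset (fun z hz => by simpa using hh z hz))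
    obtain ⟨z, hz, hzR⟩ := this
    rw [connectedComponentIn_eq hz]
    exact (isPreconnected_norm_gt R hR).subset_connectedComponentIn hzR hsub
  have hw : R < ‖((R + 1 : ℝ) : ℂ)‖ := by
    rw [Complex.norm_real, Real.norm_eq_abs, abs_of_pos (by linarith)]; linarith
  have w1 := hcont a h1 hw
  have w2 := hcont b h2 hw
  rw [connectedComponentIn_eq w1, ← connectedComponentIn_eq w2] at hmk
  exact hmk (mem_connectedComponentIn hb)

lemma NotSep.not_mem_left {X : Type*} [TopologicalSpace X] {K : Set X} {a b : X}
    (h : NotSep K a b) : a ∉ K := by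
  obtain ⟨S, -, ha, -, hd⟩ := h
  exact Set.disjoint_left.1 hd ha

lemma NotSep.not_mem_right {X : Type*} [TopologicalSpace X] {K : Set X} {a b : X}
    (h : NotSep K a b) : b ∉ K := by
  obtain ⟨S, -, -, ha, hd⟩ := h
  exact Set.disjoint_left.1 hd ha

/-- Theorem of Janiszewski. -/
lemma janiszewski_complex {K L : Set ℂ} (hK : IsCompact K) (hL : IsCompact L)
    (hKL : IsPreconnected (K ∩ L)) {a b : ℂ} (h1 : NotSep K a b) (h2 : NotSep L a b) :
    NotSep (K ∪ L) a b := by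
  classical
  apply notSep_of_hasLog (hK.union hL)
  · simp [h1.not_mem_left, h2.not_mem_left]
  · simp [h1.not_mem_right, h2.not_mem_right]
  have ha := h1.not_mem_left
  have hb := h1.not_mem_right
  obtain ⟨g1, hg1, e1⟩ := hasLog_of_notSep hK.isClosed h1
  obtain ⟨g2, hg2, e2⟩ := hasLog_of_notSep hL.isClosed h2
  have : ∃ c : ℂ, Complex.exp c = 1 ∧ ∀ z ∈ K ∩ L, g1 z = g2 z + c := by
    rcases (K ∩ L).eq_empty_or_nonempty with he | ⟨w, hw⟩
    · exact ⟨0, by simp, by simp [he]⟩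
    · have hone : ∀ z ∈ K ∩ L, Complex.exp (g1 z - g2 z) = 1 := by
        intro z hz
        have hza : z - a ≠ 0 := sub_ne_zero.2 (fun e => ha (e ▸ hz.1))
        have hzb : z - b ≠ 0 := sub_ne_zero.2 (fun e => hb (e ▸ hz.1))
        rw [Complex.exp_sub, e1 z hz.1, e2 z hz.2, div_self (div_ne_zero hza hzb)]
      refine ⟨g1 w - g2 w, hone w hw, fun z hz => ?_⟩
      have := const_of_exp_eq_one hKL (g := fun z => g1 z - g2 z)
        ((hg1.mono inter_subset_left).sub (hg2.mono inter_subset_right)) hone hz hw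
      rw [← this]; ring
  obtain ⟨c, hc, hcc⟩ := this
  refine ⟨K.piecewise g1 (fun z => g2 z + c), ?_, ?_⟩
  · apply ContinuousOn.union_of_isClosed _ _ hK.isClosed hL.isClosed
    · exact hg1.congr (fun z hz => by simp [hz])
    · refine (hg2.add (continuousOn_const (c := c))).congr (fun z hz => ?_)
      by_cases hzK : z ∈ K
      · simp [hzK, hcc z ⟨hzK, hz⟩]
      · simp [hzK]
  · intro z hz
    by_cases hzK : z ∈ K
    · simp [hzK, e1 z hzK]
    · simp [hzK, Complex.exp_add, hc, e2 z (hz.resolve_left hzK)]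

lemma arc_notSep_complex {h : ℝ → ℂ} {u v : ℝ} (huv : u ≤ v) (hc : ContinuousOn h (Icc u v))
    (hi : InjOn h (Icc u v)) {a b : ℂ} (ha : a ∉ h '' Icc u v) (hb : b ∉ h '' Icc u v) :
    NotSep (h '' Icc u v) a b := by
  refine notSep_of_hasLog (isCompact_Icc.image_of_continuousOn hc) ha hb ?_
  have hane : ∀ t ∈ Icc u v, h t - a ≠ 0 := fun t ht => sub_ne_zero.2 fun e => ha ⟨t, ht, e⟩
  have hbne : ∀ t ∈ Icc u v, h t - b ≠ 0 := fun t ht => sub_ne_zero.2 fun e => hb ⟨t, ht, e⟩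
  let F : ℝ → ℂ := fun t => (h (projIcc u v huv t) - a) / (h (projIcc u v huv t) - b)
  have hcp : Continuous fun t => h (projIcc u v huv t) := by
    have := (continuousOn_iff_continuous_domRestrict.1 hc).comp (continuous_projIcc (h := huv))
    exact this
  have hF : Continuous F :=
    (hcp.sub continuous_const).div (hcp.sub continuous_const) (fun t => hbne _ (projIcc u v huv t).2)
  obtain ⟨G, hG⟩ := exists_log (0 : ℝ) ⟨F, hF⟩
    (fun t => div_ne_zero (hane _ (projIcc u v huv t).2) (hbne _ (projIcc u v huv t).2))
  have hemb : Topology.IsClosedEmbedding (fun t : Icc u v => h t) :=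
    (continuousOn_iff_continuous_domRestrict.1 hc).isClosedEmbedding
      (fun s t hst => Subtype.ext (hi s.2 t.2 hst))
  obtain ⟨g, hg⟩ := ContinuousMap.exists_extension' hemb
    (⟨fun t : Icc u v => G t, by fun_prop⟩ : C(Icc u v, ℂ))
  refine ⟨g, g.continuous.continuousOn, ?_⟩
  rintro _ ⟨t, ht, rfl⟩
  have h1 : g (h t) = G t := congrFun hg ⟨t, ht⟩
  rw [h1, hG]
  simp [F, projIcc_of_mem huv ht]

abbrev Pl := EuclideanSpace ℝ (Fin 2)

noncomputable def plIso : ℂ ≃ₗᵢ[ℝ] Pl := Complex.orthonormalBasisOneI.repr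

lemma NotSep.image {X Y : Type*} [TopologicalSpace X] [TopologicalSpace Y] (e : X ≃ₜ Y)
    {K : Set X} {a b : X} (h : NotSep K a b) : NotSep (e '' K) (e a) (e b) := by
  obtain ⟨S, hS, ha, hb, hd⟩ := h
  exact ⟨e '' S, hS.image _ e.continuous.continuousOn, ⟨a, ha, rfl⟩, ⟨b, hb, rfl⟩,
    (Set.disjoint_image_iff e.injective).2 hd⟩

lemma janiszewski {K L : Set Pl} (hK : IsCompact K) (hL : IsCompact L)
    (hKL : IsPreconnected (K ∩ L)) {a b : Pl} (h1 : NotSep K a b) (h2 : NotSep L a b) :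
    NotSep (K ∪ L) a b := by
  let e : Pl ≃ₜ ℂ := plIso.symm.toHomeomorph
  have := janiszewski_complex (hK.image e.continuous) (hL.image e.continuous)
    (by rw [← Set.image_inter e.injective]; exact hKL.image _ e.continuous.continuousOn)
    (h1.image e) (h2.image e)
  have := this.image e.symm
  simpa [← Set.image_union, Set.image_image] using this

lemma arc_notSep {h : ℝ → Pl} {u v : ℝ} (huv : u ≤ v) (hc : ContinuousOn h (Icc u v))
    (hi : InjOn h (Icc u v)) {a b : Pl} (ha : a ∉ h '' Icc u v) (hb : b ∉ h '' Icc u v) :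
    NotSep (h '' Icc u v) a b := by
  let e : Pl ≃ₜ ℂ := plIso.symm.toHomeomorph
  have key : (e ∘ h) '' Icc u v = e '' (h '' Icc u v) := by rw [Set.image_comp]
  have := arc_notSep_complex huv (h := e ∘ h) (e.continuous.comp_continuousOn hc)
    (e.injective.comp_injOn hi) (a := e a) (b := e b)
    (by rw [key, e.injective.mem_set_image]; exact ha)
    (by rw [key, e.injective.mem_set_image]; exact hb)
  rw [key] at this
  have := this.image e.symm
  simpa [Set.image_image] using this

lemma jordan_loop₀ {J : Set Pl} (hJ : IsJordanCurve J) :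
    ∃ h : ℝ → Pl, Continuous h ∧ (∀ t, h (t + 1) = h t) ∧
      (∀ c, InjOn h (Ico c (c + 1))) ∧ range h = J := by
  obtain ⟨f, hf, hfi, hr⟩ := hJ
  have hn : ∀ z : Circle, plIso (z : ℂ) ∈ sphere (0 : Pl) 1 := fun z => by
    rw [mem_sphere_zero_iff_norm, plIso.norm_map]; exact Circle.norm_coe z
  let q : ℝ → sphere (0 : Pl) 1 := fun t => ⟨plIso (AddCircle.toCircle (t : AddCircle (1:ℝ)) : ℂ), hn _⟩
  have hq : Continuous q := by
    refine Continuous.subtype_mk ?_ _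
    refine plIso.continuous.comp (continuous_subtype_val.comp (AddCircle.continuous_toCircle.comp ?_))
    exact AddCircle.continuous_mk' 1
  have hqe : ∀ s t, q s = q t → (s : AddCircle (1:ℝ)) = t := by
    intro s t hst
    have h1 := plIso.injective (congrArg Subtype.val hst)
    exact AddCircle.injective_toCircle one_ne_zero (Circle.coe_injective h1)
  refine ⟨fun t => f (q t), hf.comp hq, ?_, ?_, ?_⟩
  · intro t
    have : ((t + 1 : ℝ) : AddCircle (1:ℝ)) = t := by simp
    simp only [q, this]
  · intro c s hs t ht hst
    have : Fact ((0:ℝ) < 1) := ⟨one_pos⟩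
    exact (AddCircle.coe_eq_coe_iff_of_mem_Ico hs ht).1 (hqe _ _ (hfi hst))
  · rw [← hr]
    apply Set.Subset.antisymm
    · rintro _ ⟨t, rfl⟩; exact ⟨_, rfl⟩
    · rintro _ ⟨⟨y, hy⟩, rfl⟩
      have hy' : ‖plIso.symm y‖ = 1 := by simpa using hy
      let z : Circle := ⟨plIso.symm y, by simpa [Submonoid.unitSphere] using hy'⟩
      obtain ⟨w, hw⟩ := (AddCircle.homeomorphCircle (T := (1:ℝ)) one_ne_zero).surjective z
      obtain ⟨t, rfl⟩ := QuotientAddGroup.mk_surjective w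
      refine ⟨t, ?_⟩
      refine congrArg f (Subtype.ext ?_)
      rw [AddCircle.homeomorphCircle_apply] at hw
      change plIso (AddCircle.toCircle (t : AddCircle (1:ℝ)) : ℂ) = y
      erw [hw]
      simp [z]

lemma jordan_loop {J : Set Pl} (hJ : IsJordanCurve J) {p : Pl} (hp : p ∈ J) :
    ∃ h : ℝ → Pl, Continuous h ∧ h 0 = p ∧ (∀ t, h (t + 1) = h t) ∧
      (∀ c, InjOn h (Ico c (c + 1))) ∧ h '' Icc 0 1 = J := by
  obtain ⟨h, hc, hper, hi, hr⟩ := jordan_loop₀ hJ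
  rw [← hr] at hp
  obtain ⟨t₀, rfl⟩ := hp
  refine ⟨fun t => h (t + t₀), by fun_prop, by simp, ?_, ?_, ?_⟩
  · intro t
    change h (t + 1 + t₀) = h (t + t₀)
    rw [show t + 1 + t₀ = t + t₀ + 1 by ring, hper]
  · intro c s hs t ht hst
    have := hi (c + t₀) (x₁ := s + t₀) (x₂ := t + t₀) ⟨by linarith [hs.1], by linarith [hs.2]⟩
      ⟨by linarith [ht.1], by linarith [ht.2]⟩ hst
    linarith
  · rw [← hr]
    apply Set.Subset.antisymm
    · rintro _ ⟨t, -, rfl⟩; exact ⟨_, rfl⟩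
    · rintro _ ⟨t, rfl⟩
      have hp1 : Function.Periodic h 1 := hper
      obtain ⟨s, hs, e⟩ := hp1.exists_mem_Ico one_pos t t₀
      exact ⟨s - t₀, ⟨by linarith [hs.1], by linarith [hs.2]⟩, by simp [e]⟩

lemma loop_jordan {h : ℝ → Pl} (hc : ContinuousOn h (Icc 0 1)) (h01 : h 0 = h 1)
    (hi : InjOn h (Ico 0 1)) : IsJordanCurve (h '' Icc 0 1) := by
  have : Fact ((0:ℝ) < 1) := ⟨one_pos⟩
  let q : sphere (0 : Pl) 1 → Circle := fun y => ⟨plIso.symm y, by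
    have := y.2
    simpa [Submonoid.unitSphere] using this⟩
  have hq : Continuous q := by
    refine Continuous.subtype_mk ?_ _
    exact plIso.symm.continuous.comp continuous_subtype_val
  have hqi : Function.Injective q := by
    intro s t hst
    have h1 : plIso.symm (s : Pl) = plIso.symm t := congrArg Subtype.val hst
    exact Subtype.ext (plIso.symm.injective h1)
  have hqs : Function.Surjective q := by
    intro z
    refine ⟨⟨plIso (z : ℂ), by
      rw [mem_sphere_zero_iff_norm, plIso.norm_map]; exact Circle.norm_coe z⟩, ?_⟩
    apply Circle.ext
    change plIso.symm (plIso (z : ℂ)) = z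
    simp
  let e := (AddCircle.homeomorphCircle (T := (1:ℝ)) one_ne_zero).symm
  let L : AddCircle (1:ℝ) → Pl := AddCircle.liftIco 1 0 h
  have hL : Continuous L := AddCircle.liftIco_continuous (by simpa using h01) (by simpa using hc)
  have hLa : ∀ t ∈ Ico (0:ℝ) 1, L (t : AddCircle (1:ℝ)) = h t := fun t ht =>
    AddCircle.liftIco_coe_apply (by simpa using ht)
  have hrep : ∀ x : AddCircle (1:ℝ), ∃ t ∈ Ico (0:ℝ) 1, (t : AddCircle (1:ℝ)) = x := by
    intro x
    obtain ⟨t, ht, e⟩ := (AddCircle.coe_image_Ico_eq (1:ℝ) 0).ge (Set.mem_univ x)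
    exact ⟨t, by simpa using ht, e⟩
  have hLi : Function.Injective L := by
    intro x y hxy
    obtain ⟨s, hs, rfl⟩ := hrep x
    obtain ⟨t, ht, rfl⟩ := hrep y
    rw [hLa s hs, hLa t ht] at hxy
    rw [hi hs ht hxy]
  refine ⟨fun y => L (e (q y)), hL.comp (e.continuous.comp hq),
    hLi.comp (e.injective.comp hqi), ?_⟩
  apply Set.Subset.antisymm
  · rintro _ ⟨y, rfl⟩
    obtain ⟨t, ht, e'⟩ := hrep (e (q y))
    refine ⟨t, Ico_subset_Icc_self ht, ?_⟩
    simp only [← e', hLa t ht]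
  · have : ∀ t ∈ Ico (0:ℝ) 1, h t ∈ range fun y => L (e (q y)) := by
      intro t ht
      obtain ⟨z, hz⟩ := e.surjective (t : AddCircle (1:ℝ))
      obtain ⟨y, rfl⟩ := hqs z
      exact ⟨y, by simp only [hz, hLa t ht]⟩
    rintro _ ⟨t, ht, rfl⟩
    rcases ht.2.lt_or_eq with h1 | h1
    · exact this t ⟨ht.1, h1⟩
    · rw [h1, ← h01]
      exact this 0 ⟨le_rfl, one_pos⟩

/-- `K` is an arc from `a` to `b`. -/
def IsArc (K : Set Pl) (a b : Pl) : Prop :=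
  ∃ (h : ℝ → Pl) (u v : ℝ), u < v ∧ ContinuousOn h (Icc u v) ∧ InjOn h (Icc u v) ∧
    h u = a ∧ h v = b ∧ h '' Icc u v = K

lemma IsArc.isCompact {K : Set Pl} {a b : Pl} (h : IsArc K a b) : IsCompact K := by
  obtain ⟨h, u, v, huv, hc, hi, ha, hb, rfl⟩ := h
  exact isCompact_Icc.image_of_continuousOn hc

lemma IsArc.isPreconnected {K : Set Pl} {a b : Pl} (h : IsArc K a b) : IsPreconnected K := by
  obtain ⟨h, u, v, huv, hc, hi, ha, hb, rfl⟩ := h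
  exact isPreconnected_Icc.image _ hc

lemma IsArc.left_mem {K : Set Pl} {a b : Pl} (h : IsArc K a b) : a ∈ K := by
  obtain ⟨h, u, v, huv, hc, hi, ha, hb, rfl⟩ := h
  exact ⟨u, ⟨le_rfl, huv.le⟩, ha⟩

lemma IsArc.right_mem {K : Set Pl} {a b : Pl} (h : IsArc K a b) : b ∈ K := by
  obtain ⟨h, u, v, huv, hc, hi, ha, hb, rfl⟩ := h
  exact ⟨v, ⟨huv.le, le_rfl⟩, hb⟩

lemma IsArc.symm {K : Set Pl} {a b : Pl} (h : IsArc K a b) : IsArc K b a := by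
  obtain ⟨h, u, v, huv, hc, hi, ha, hb, rfl⟩ := h
  refine ⟨fun t => h (-t), -v, -u, by linarith, ?_, ?_, by simpa, by simpa, ?_⟩
  · exact hc.comp (by fun_prop) (fun t ht => ⟨by linarith [ht.2], by linarith [ht.1]⟩)
  · intro s hs t ht hst
    have := hi (x₁ := -s) (x₂ := -t) ⟨by linarith [hs.2], by linarith [hs.1]⟩
      ⟨by linarith [ht.2], by linarith [ht.1]⟩ hst
    linarith
  · rw [show (fun t => h (-t)) = h ∘ (fun t => -t) from rfl, Set.image_comp]
    simp

/-- normalise the parameter interval -/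
lemma IsArc.normalize {K : Set Pl} {a b : Pl} (h : IsArc K a b) {u' v' : ℝ} (huv' : u' < v') :
    ∃ h : ℝ → Pl, ContinuousOn h (Icc u' v') ∧ InjOn h (Icc u' v') ∧
    h u' = a ∧ h v' = b ∧ h '' Icc u' v' = K := by
  obtain ⟨h, u, v, huv, hc, hi, ha, hb, rfl⟩ := h
  have hd : 0 < v' - u' := by linarith
  set m := (v - u) / (v' - u') with hm
  have hmpos : 0 < m := div_pos (by linarith) hd
  have hmd : m * (v' - u') = v - u := by rw [hm]; field_simp
  let φ : ℝ → ℝ := fun t => u + m * (t - u')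
  have hmap : ∀ t ∈ Icc u' v', φ t ∈ Icc u v := fun t ht =>
    ⟨by have := mul_nonneg hmpos.le (sub_nonneg.2 ht.1); simp only [φ]; linarith,
     by have := mul_le_mul_of_nonneg_left (sub_le_sub_right ht.2 u') hmpos.le
        simp only [φ]; linarith⟩
  have hsurj : ∀ s ∈ Icc u v, ∃ t ∈ Icc u' v', φ t = s := by
    intro s hs
    have e : m * ((s - u) / m) = s - u := by field_simp
    refine ⟨u' + (s - u) / m, ⟨?_, ?_⟩, ?_⟩
    · have := div_nonneg (sub_nonneg.2 hs.1) hmpos.le; linarith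
    · have : (s - u) / m ≤ v' - u' := by
        rw [div_le_iff₀ hmpos]; linarith [hs.2]
      linarith
    · simp only [φ, add_sub_cancel_left, e]; ring
  refine ⟨h ∘ φ, hc.comp (by fun_prop) hmap, ?_, ?_, ?_, ?_⟩
  · refine hi.comp ?_ hmap
    intro s _ t _ hst
    have hst : u + m * (s - u') = u + m * (t - u') := hst
    have := mul_left_cancel₀ hmpos.ne' (add_left_cancel hst)
    linarith
  · simp [φ, ha]
  · simp [φ, hmd, hb]
  · apply Set.Subset.antisymm
    · rintro _ ⟨t, ht, rfl⟩; exact ⟨_, hmap t ht, rfl⟩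
    · rintro _ ⟨s, hs, rfl⟩
      obtain ⟨t, ht, rfl⟩ := hsurj s hs
      exact ⟨t, ht, rfl⟩

lemma arc_union_jordan {A B : Set Pl} {a b : Pl} (hA : IsArc A a b) (hB : IsArc B a b)
    (hAB : A ∩ B ⊆ {a, b}) : IsJordanCurve (A ∪ B) := by
  classical
  obtain ⟨f, fc, fi, f0, f1, rfl⟩ := hA.normalize (u' := 0) (v' := 1/2) (by norm_num)
  obtain ⟨g, gc, gi, g0, g1, rfl⟩ := hB.symm.normalize (u' := 1/2) (v' := 1) (by norm_num)
  let h : ℝ → Pl := (Icc (0:ℝ) (1/2)).piecewise f g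
  have hU : Icc (0:ℝ) 1 = Icc 0 (1/2) ∪ Icc (1/2) 1 :=
    (Icc_union_Icc_eq_Icc (by norm_num) (by norm_num)).symm
  have hf : ∀ t ∈ Icc (0:ℝ) (1/2), h t = f t := fun t ht => by simp only [h]; exact piecewise_eq_of_mem _ _ _ ht
  have hg : ∀ t ∈ Icc (1/2:ℝ) 1, h t = g t := fun t ht => by
    by_cases h' : t ∈ Icc (0:ℝ) (1/2)
    · have : t = 1/2 := le_antisymm h'.2 ht.1
      rw [hf t h', this, f1, g0]
    · simp only [h]; exact piecewise_eq_of_notMem _ _ _ h'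
  have key : h '' Icc 0 1 = f '' Icc 0 (1/2) ∪ g '' Icc (1/2) 1 := by
    rw [hU, Set.image_union, Set.image_congr hf, Set.image_congr hg]
  rw [← key]
  have m0 : (0:ℝ) ∈ Icc (0:ℝ) (1/2) := by norm_num
  have mh : (1/2:ℝ) ∈ Icc (0:ℝ) (1/2) := by norm_num
  have mh' : (1/2:ℝ) ∈ Icc (1/2:ℝ) 1 := by norm_num
  have m1 : (1:ℝ) ∈ Icc (1/2:ℝ) 1 := by norm_num
  have cross : ∀ s ∈ Icc (0:ℝ) (1/2), ∀ t ∈ Ico (1/2:ℝ) 1, f s = g t → s = t := by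
    intro s hs t ht hst
    have ht' : t ∈ Icc (1/2:ℝ) 1 := ⟨ht.1, ht.2.le⟩
    rcases hAB ⟨⟨s, hs, rfl⟩, ⟨t, ht', hst.symm⟩⟩ with h1 | h1
    · have : t = 1 := gi ht' m1 (by rw [g1, ← hst, h1])
      linarith [ht.2]
    · have h1 : f s = b := h1
      have e1 : t = 1/2 := gi ht' mh' (by rw [g0, ← hst, h1])
      have e2 : s = 1/2 := fi hs mh (by rw [f1, h1])
      rw [e1, e2]
  apply loop_jordan
  · rw [hU]
    exact ContinuousOn.union_of_isClosed (fc.congr hf) (gc.congr hg) isClosed_Icc isClosed_Icc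
  · rw [hf 0 m0, hg 1 m1, f0, g1]
  · intro s hs t ht hst
    rcases le_total s (1/2) with s1 | s1 <;> rcases le_total t (1/2) with t1 | t1
    · rw [hf s ⟨hs.1, s1⟩, hf t ⟨ht.1, t1⟩] at hst
      exact fi ⟨hs.1, s1⟩ ⟨ht.1, t1⟩ hst
    · rw [hf s ⟨hs.1, s1⟩, hg t ⟨t1, ht.2.le⟩] at hst
      exact cross s ⟨hs.1, s1⟩ t ⟨t1, ht.2⟩ hst
    · rw [hg s ⟨s1, hs.2.le⟩, hf t ⟨ht.1, t1⟩] at hst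
      exact (cross t ⟨ht.1, t1⟩ s ⟨s1, hs.2⟩ hst.symm).symm
    · rw [hg s ⟨s1, hs.2.le⟩, hg t ⟨t1, ht.2.le⟩] at hst
      exact gi ⟨s1, hs.2.le⟩ ⟨t1, ht.2.le⟩ hst

lemma loop_arc {h : ℝ → Pl} (hc : Continuous h) (hi : ∀ c, InjOn h (Ico c (c + 1))) {u v : ℝ}
    (huv : u < v) (hv : v < u + 1) : IsArc (h '' Icc u v) (h u) (h v) :=
  ⟨h, u, v, huv, hc.continuousOn, (hi u).mono (Icc_subset_Ico_right hv), rfl, rfl, rfl⟩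

/-- Splitting a loop at two parameters. -/
lemma loop_split {h : ℝ → Pl} (hc : Continuous h) (hper : ∀ t, h (t + 1) = h t)
    (hi : ∀ c, InjOn h (Ico c (c + 1))) {s t : ℝ} (h0 : 0 ≤ s) (hst : s < t) (h1 : t ≤ 1)
    (hlt : t < s + 1) :
    IsArc (h '' Icc s t) (h s) (h t) ∧ IsArc (h '' Icc t (s + 1)) (h s) (h t) ∧
    h '' Icc 0 1 = h '' Icc s t ∪ h '' Icc t (s + 1) ∧
    h '' Icc s t ∩ h '' Icc t (s + 1) = {h s, h t} := by
  refine ⟨loop_arc hc hi hst hlt, ?_, ?_, ?_⟩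
  · have := (loop_arc hc hi (u := t) (v := s + 1) hlt (by linarith)).symm
    rwa [hper] at this
  · apply Set.Subset.antisymm
    · rintro _ ⟨r, hr, rfl⟩
      rcases lt_or_ge r s with h2 | h2
      · right
        exact ⟨r + 1, ⟨by linarith [hr.1], by linarith⟩, hper r⟩
      · rcases le_total r t with h3 | h3
        · left; exact ⟨r, ⟨h2, h3⟩, rfl⟩
        · right; exact ⟨r, ⟨h3, by linarith [hr.2]⟩, rfl⟩
    · rintro _ (⟨r, hr, rfl⟩ | ⟨r, hr, rfl⟩)
      · exact ⟨r, ⟨by linarith [hr.1], by linarith [hr.2]⟩, rfl⟩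
      · rcases le_total r 1 with h2 | h2
        · exact ⟨r, ⟨by linarith [hr.1], h2⟩, rfl⟩
        · refine ⟨r - 1, ⟨by linarith, by linarith [hr.2]⟩, ?_⟩
          rw [← hper, sub_add_cancel]
  · apply Set.Subset.antisymm
    · rintro _ ⟨⟨r, hr, rfl⟩, ⟨r', hr', e⟩⟩
      rcases hr'.2.lt_or_eq with h2 | h2
      · have : r' = r := hi s ⟨by linarith [hr'.1], h2⟩ ⟨hr.1, by linarith [hr.2]⟩ e
        have : r = t := le_antisymm hr.2 (this ▸ hr'.1)
        simp [this]
      · rw [h2, hper] at e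
        simp [e]
    · rintro _ (rfl | rfl)
      · exact ⟨⟨s, ⟨le_rfl, hst.le⟩, rfl⟩, ⟨s + 1, ⟨hlt.le, le_rfl⟩, hper s⟩⟩
      · exact ⟨⟨t, ⟨hst.le, le_rfl⟩, rfl⟩, ⟨t, ⟨le_rfl, hlt.le⟩, rfl⟩⟩

lemma jordan_split {J : Set Pl} (hJ : IsJordanCurve J) {a b : Pl} (ha : a ∈ J) (hb : b ∈ J)
    (hab : a ≠ b) : ∃ J₁ J₂ : Set Pl, IsArc J₁ a b ∧ IsArc J₂ a b ∧ J = J₁ ∪ J₂ ∧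
      J₁ ∩ J₂ = {a, b} := by
  obtain ⟨h, hc, rfl, hper, hi, rfl⟩ := jordan_loop hJ ha
  obtain ⟨t, ht, rfl⟩ := hb
  have h1 : h 1 = h 0 := by simpa using hper 0
  have t0 : 0 < t := lt_of_le_of_ne ht.1 (fun e => hab (by rw [e]))
  have t1 : t < 1 := lt_of_le_of_ne ht.2 (fun e => hab (by rw [e, h1]))
  exact ⟨_, _, loop_split hc hper hi le_rfl t0 t1.le (by linarith)⟩

lemma crosscut {C J : Set Pl} (hC : IsJordanCurve C) (hJ : IsClosed J)
    (hn : (C ∩ J).Nontrivial) {p : Pl} (hpC : p ∈ C) (hpJ : p ∉ J) :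
    ∃ (a b : Pl) (γ C' : Set Pl), a ≠ b ∧ a ∈ C ∩ J ∧ b ∈ C ∩ J ∧ IsArc γ a b ∧ IsArc C' a b ∧
      C = C' ∪ γ ∧ C' ∩ γ = {a, b} ∧ γ ∩ J ⊆ {a, b} ∧ p ∈ γ := by
  obtain ⟨h, hc, rfl, hper, hi, rfl⟩ := jordan_loop hC hpC
  have h1 : h 1 = h 0 := by simpa using hper 0
  let S : Set ℝ := Icc 0 1 ∩ h ⁻¹' J
  have hS : IsCompact S := isCompact_Icc.inter_right (hJ.preimage hc)
  have hSn : S.Nonempty := by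
    obtain ⟨_, ⟨⟨t, ht, rfl⟩, hj⟩⟩ := hn.nonempty
    exact ⟨t, ht, hj⟩
  obtain ⟨s, hs, hsm⟩ := hS.exists_isLeast hSn
  obtain ⟨t, ht, htm⟩ := hS.exists_isGreatest hSn
  have hs0 : 0 < s := lt_of_le_of_ne hs.1.1 (fun e => hpJ (by rw [e]; exact hs.2))
  have ht1 : t < 1 := lt_of_le_of_ne ht.1.2 (fun e => hpJ (by rw [← h1, ← e]; exact ht.2))
  have hst : s < t := by
    refine lt_of_le_of_ne (hsm ht) (fun e => ?_)
    obtain ⟨_, ⟨⟨x, hx, rfl⟩, hxj⟩, _, ⟨⟨y, hy, rfl⟩, hyj⟩, hxy⟩ := hn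
    have ex : x = s := le_antisymm (e ▸ htm ⟨hx, hxj⟩) (hsm ⟨hx, hxj⟩)
    have ey : y = s := le_antisymm (e ▸ htm ⟨hy, hyj⟩) (hsm ⟨hy, hyj⟩)
    exact hxy (by rw [ex, ey])
  obtain ⟨p1, p2, p3, p4⟩ := loop_split hc hper hi hs.1.1 hst ht.1.2 (by linarith)
  refine ⟨h s, h t, h '' Icc t (s + 1), h '' Icc s t, ?_, ⟨⟨s, hs.1, rfl⟩, hs.2⟩,
    ⟨⟨t, ht.1, rfl⟩, ht.2⟩, p2, p1, p3, p4, ?_, ?_⟩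
  · intro e
    exact hst.ne (hi 0 ⟨hs0.le, by linarith⟩ ⟨by linarith, by linarith⟩ e)
  · rintro _ ⟨⟨r, hr, rfl⟩, hrj⟩
    rcases le_total r 1 with h2 | h2
    · have : r = t := le_antisymm (htm ⟨⟨by linarith [hr.1], h2⟩, hrj⟩) hr.1
      simp [this]
    · have e : h r = h (r - 1) := by rw [← hper (r - 1), sub_add_cancel]
      have : r - 1 = s := le_antisymm (by linarith [hr.2])
        (hsm ⟨⟨by linarith, by linarith [hr.2]⟩, by
          change h (r - 1) ∈ J
          rw [← e]; exact hrj⟩)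
      rw [e, this]; simp
  · exact ⟨1, ⟨ht1.le, by linarith⟩, h1⟩

lemma frontier_meets {X : Type*} [TopologicalSpace X] {S W : Set X} (hS : IsPreconnected S)
    (h1 : (S ∩ W).Nonempty) (h2 : (S ∩ Wᶜ).Nonempty) : (S ∩ frontier W).Nonempty := by
  by_contra hne
  have hnf : ∀ z ∈ S, z ∉ frontier W := fun z hz hf => hne ⟨z, hz, hf⟩
  have hin : ∀ z ∈ S, z ∈ W → z ∈ interior W := fun z hz hw => by
    by_contra hi
    exact hnf z hz ⟨subset_closure hw, hi⟩
  have hout : ∀ z ∈ S, z ∉ W → z ∈ (closure W)ᶜ := fun z hz hw hcl =>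
    hnf z hz ⟨hcl, fun hi => hw (interior_subset hi)⟩
  obtain ⟨x, hx, hxW⟩ := h1
  obtain ⟨y, hy, hyW⟩ := h2
  obtain ⟨z, hz, hz1, hz2⟩ := hS (interior W) (closure W)ᶜ isOpen_interior
    isClosed_closure.isOpen_compl (fun z hz => by
      by_cases h : z ∈ W
      · exact Or.inl (hin z hz h)
      · exact Or.inr (hout z hz h)) ⟨x, hx, hin x hx hxW⟩ ⟨y, hy, hout y hy hyW⟩
  exact hz2 (subset_closure (interior_subset hz1))

lemma frontier_full {J W : Set Pl} (hJ : IsJordanCurve J) (hfr : frontier W ⊆ J)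
    (hWJ : Disjoint W J) {w z : Pl} (hw : w ∈ W) (hz : z ∉ W) (hzJ : z ∉ J) : frontier W = J := by
  refine hfr.antisymm (fun p hp => ?_)
  by_contra hpf
  obtain ⟨h, hc, rfl, hper, hi, rfl⟩ := jordan_loop hJ hp
  have h1 : h 1 = h 0 := by simpa using hper 0
  have o0 : ∀ᶠ ε in 𝓝 (0:ℝ), h ε ∉ frontier W :=
    hc.continuousAt.eventually_mem (isClosed_frontier.isOpen_compl.mem_nhds hpf)
  obtain ⟨r, hr, hball⟩ := Metric.eventually_nhds_iff.1 o0
  set ε := min (r / 2) (1 / 4) with hε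
  have hε0 : 0 < ε := by positivity
  have hεr : ε < r := (min_le_left _ _).trans_lt (by linarith)
  have hε4 : ε ≤ 1 / 4 := min_le_right _ _
  have hsub : frontier W ⊆ h '' Icc ε (1 - ε) := by
    intro y hy
    obtain ⟨t, ht, rfl⟩ := hfr hy
    refine ⟨t, ⟨?_, ?_⟩, rfl⟩
    · by_contra! hlt
      refine hball (y := t) ?_ hy
      rw [Real.dist_eq, sub_zero, abs_of_nonneg ht.1]; linarith
    · by_contra! hlt
      have e : h t = h (t - 1) := by rw [← hper (t - 1), sub_add_cancel]
      rw [e] at hy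
      refine hball (y := t - 1) ?_ hy
      rw [Real.dist_eq, sub_zero, abs_of_nonpos (by linarith [ht.2])]; linarith
  have hKJ : h '' Icc ε (1 - ε) ⊆ h '' Icc 0 1 :=
    Set.image_mono (Icc_subset_Icc hε0.le (by linarith))
  obtain ⟨S, hS, hwS, hzS, hd⟩ := arc_notSep (h := h) (u := ε) (v := 1 - ε) (by linarith)
    hc.continuousOn ((hi 0).mono (Set.Subset.trans (Icc_subset_Ico_right (by linarith)) (Ico_subset_Ico_left hε0.le)))
    (a := w) (b := z) (fun hh => Set.disjoint_left.1 hWJ hw (hKJ hh)) (fun hh => hzJ (hKJ hh))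
  obtain ⟨y, hyS, hyf⟩ := frontier_meets hS ⟨w, hwS, hw⟩ ⟨z, hzS, hz⟩
  exact Set.disjoint_left.1 hd hyS (hsub hyf)

lemma comp_frontier_subset {X : Type*} [TopologicalSpace X] [LocallyConnectedSpace X]
    {U F : Set X} (hU : IsOpen U) (hF : frontier U ⊆ F) (x : X) :
    frontier (connectedComponentIn U x) ⊆ F := by
  intro y hy
  apply hF
  rw [hU.frontier_eq]
  exact ⟨closure_mono (connectedComponentIn_subset _ _) hy.1,
    Set.disjoint_left.1 (frontier_comp_subset hU x) hy⟩

/-- join two connected sets through a ball around a common closure point -/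
lemma notSep_join {K S T : Set Pl} (hK : IsClosed K) (hS : IsPreconnected S)
    (hT : IsPreconnected T) (hSK : Disjoint S K) (hTK : Disjoint T K) {p a b : Pl} (hp : p ∉ K)
    (hpS : p ∈ closure S) (hpT : p ∈ closure T) (ha : a ∈ S) (hb : b ∈ T) : NotSep K a b := by
  have hS' : IsPreconnected (insert p S) := hS.subset_closure (subset_insert _ _)
    (insert_subset hpS subset_closure)
  have hT' : IsPreconnected (insert p T) := hT.subset_closure (subset_insert _ _)
    (insert_subset hpT subset_closure)
  refine ⟨_, hS'.union p (mem_insert _ _) (mem_insert _ _) hT', Or.inl (Or.inr ha),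
    Or.inr (Or.inr hb), ?_⟩
  rw [Set.disjoint_left] at *
  rintro z ((rfl | hz) | (rfl | hz))
  exacts [hp, hSK hz, hp, hTK hz]

lemma exists_exterior {V : Set Pl} (hVb : Bornology.IsBounded V) : ∃ e, e ∉ closure V := by
  by_contra! h
  have hc : IsCompact (closure V) := hVb.isCompact_closure
  rw [eq_univ_of_forall h] at hc
  exact noncompact_univ Pl hc

/-- The component of an exterior point of a bounded Jordan region. -/
lemma exterior_comp {V : Set Pl} (hV : IsJordanRegion V) {x e : Pl} (hx : x ∈ V)
    (he : e ∉ closure V) :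
    IsPreconnected (connectedComponentIn (frontier V)ᶜ e) ∧
    e ∈ connectedComponentIn (frontier V)ᶜ e ∧
    Disjoint (connectedComponentIn (frontier V)ᶜ e) (closure V) ∧
    frontier (connectedComponentIn (frontier V)ᶜ e) = frontier V := by
  set E := connectedComponentIn (frontier V)ᶜ e with hE
  have hef : e ∉ frontier V := fun h => he h.1
  have heE : e ∈ E := mem_connectedComponentIn hef
  have hpre : IsPreconnected E := isPreconnected_connectedComponentIn
  have hEs : E ⊆ (frontier V)ᶜ := connectedComponentIn_subset _ _
  have hop : IsOpen (frontier V)ᶜ := isClosed_frontier.isOpen_compl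
  have hdV : Disjoint E V := by
    rw [Set.disjoint_left]
    intro z hz hzV
    obtain ⟨y, hy, hyf⟩ := frontier_meets hpre ⟨z, hz, hzV⟩ ⟨e, heE, fun h => he (subset_closure h)⟩
    exact hEs hy hyf
  have hdc : Disjoint E (closure V) := hdV.closure_right hop.connectedComponentIn
  refine ⟨hpre, heE, hdc, ?_⟩
  refine frontier_full hV.2 ?_ (Set.disjoint_left.2 (fun z hz => hEs hz)) heE
    (fun h => Set.disjoint_left.1 hdV h hx) (z := x) ?_
  · intro y hy
    by_contra h
    exact Set.disjoint_left.1 (frontier_comp_subset hop e) hy h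
  · rw [hV.1.frontier_eq]; exact fun h => h.2 hx

/-- One side of a crosscut. -/
lemma crosscut_side {V γ J₁ J₂ : Set Pl} (hV : IsJordanRegion V) (hVb : Bornology.IsBounded V)
    {a b : Pl} (hγ : IsArc γ a b) (hJ₁ : IsArc J₁ a b) (hJ₂ : IsArc J₂ a b)
    (hJ : frontier V = J₁ ∪ J₂) (hJJ : J₁ ∩ J₂ = {a, b}) (hγV : γ ⊆ closure V)
    {x : Pl} (hx : x ∈ V \ γ) :
    frontier (connectedComponentIn (V \ γ) x) ⊆ γ ∪ J₁ ∨
    frontier (connectedComponentIn (V \ γ) x) ⊆ γ ∪ J₂ := by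
  obtain ⟨e, he⟩ := exists_exterior hVb
  obtain ⟨hE, heE, hEV, hEf⟩ := exterior_comp hV hx.1 he
  set E := connectedComponentIn (frontier V)ᶜ e
  have hop : IsOpen (V \ γ) := hV.1.sdiff hγ.isCompact.isClosed
  set W := connectedComponentIn (V \ γ) x with hW
  have hWs : W ⊆ V \ γ := connectedComponentIn_subset _ _
  have hxW : x ∈ W := mem_connectedComponentIn hx
  have hVJ : ∀ z ∈ V, z ∉ frontier V := fun z hz h => by
    rw [hV.1.frontier_eq] at h; exact h.2 hz
  have hfr : frontier W ⊆ γ ∪ (J₁ ∪ J₂) := by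
    intro y hy
    by_cases hyV : y ∈ V
    · left
      by_contra hyγ
      exact Set.disjoint_left.1 (frontier_comp_subset hop x) hy ⟨hyV, hyγ⟩
    · right
      rw [← hJ, hV.1.frontier_eq]
      exact ⟨closure_mono (hWs.trans sdiff_subset) hy.1, hyV⟩
  by_contra! hcon
  obtain ⟨h1, h2⟩ := hcon
  have key : ∀ K : Set Pl, IsCompact K → K ⊆ frontier V → ¬ frontier W ⊆ γ ∪ K →
      NotSep (γ ∪ K) x e := by
    intro K hK hKJ hn
    obtain ⟨q, hq, hqn⟩ := Set.not_subset.1 hn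
    have hqJ : q ∈ frontier V := by
      rcases hfr hq with h | h
      · exact absurd (Or.inl h) hqn
      · rwa [hJ]
    refine notSep_join (hγ.isCompact.union hK).isClosed isPreconnected_connectedComponentIn hE
      ?_ ?_ hqn hq.1 (hEf.symm ▸ hqJ : q ∈ frontier E).1 hxW heE
    · rw [Set.disjoint_left]
      rintro z hz (h | h)
      · exact (hWs hz).2 h
      · exact hVJ z (hWs hz).1 (hKJ h)
    · refine hEV.mono_right (union_subset hγV (hKJ.trans frontier_subset_closure))
  have k1 := key J₁ hJ₁.isCompact (hJ ▸ subset_union_left) h1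
  have k2 := key J₂ hJ₂.isCompact (hJ ▸ subset_union_right) h2
  have hinter : (γ ∪ J₁) ∩ (γ ∪ J₂) = γ := by
    rw [← Set.union_inter_distrib_left, hJJ]
    apply union_eq_self_of_subset_right
    rintro z (rfl | rfl)
    exacts [hγ.left_mem, hγ.right_mem]
  obtain ⟨S, hS, hxS, heS, hd⟩ := janiszewski (hγ.isCompact.union hJ₁.isCompact)
    (hγ.isCompact.union hJ₂.isCompact) (hinter.symm ▸ hγ.isPreconnected) k1 k2
  obtain ⟨y, hyS, hyf⟩ := frontier_meets hS ⟨x, hxS, hx.1⟩ ⟨e, heS, fun h => he (subset_closure h)⟩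
  refine Set.disjoint_left.1 hd hyS ?_
  rw [hJ] at hyf
  rcases hyf with h | h
  exacts [Or.inl (Or.inr h), Or.inr (Or.inr h)]

/-- The component of `V \ closure Ω` is a component of `V \ γ`. -/
lemma comp_eq {Ω V γ C' J₂ : Set Pl} (hΩ : IsJordanRegion Ω) (hV : IsJordanRegion V)
    (hsub : Ω ⊆ V) {a b p x : Pl} (hγ : IsArc γ a b) (hC' : IsArc C' a b)
    (hC : frontier Ω = C' ∪ γ) (hCC : C' ∩ γ = {a, b}) (hJ₂ : IsArc J₂ a b)
    (hJ₂V : J₂ ⊆ frontier V) (hx : x ∈ V \ closure Ω) (hpV : p ∉ frontier V) (hpC : p ∉ C')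
    (hpγ : p ∈ γ) (hpW : p ∈ frontier (connectedComponentIn (V \ closure Ω) x)) :
    connectedComponentIn (V \ closure Ω) x = connectedComponentIn (V \ γ) x := by
  have hγΩ : γ ⊆ closure Ω := fun z hz => by
    have : z ∈ frontier Ω := hC ▸ Or.inr hz
    exact this.1
  have hVJ : ∀ z ∈ V, z ∉ frontier V := fun z hz h => by
    rw [hV.1.frontier_eq] at h; exact h.2 hz
  have hΩC : ∀ z ∈ Ω, z ∉ frontier Ω := fun z hz h => by
    rw [hΩ.1.frontier_eq] at h; exact h.2 hz
  have hle : V \ closure Ω ⊆ V \ γ := fun z hz => ⟨hz.1, fun h => hz.2 (hγΩ h)⟩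
  have hop : IsOpen (V \ γ) := hV.1.sdiff hγ.isCompact.isClosed
  set W := connectedComponentIn (V \ closure Ω) x with hW
  set W' := connectedComponentIn (V \ γ) x with hW'
  have hWs : W ⊆ V \ closure Ω := connectedComponentIn_subset _ _
  have hWs' : W' ⊆ V \ γ := connectedComponentIn_subset _ _
  have hxW : x ∈ W := mem_connectedComponentIn hx
  have hxW' : x ∈ W' := mem_connectedComponentIn (hle hx)
  refine (connectedComponentIn_mono x hle).antisymm ?_
  have hdisj : Disjoint W' Ω := by
    rw [Set.disjoint_left]
    intro o ho hoΩ
    set Ω₀ := connectedComponentIn Ω o with hΩ₀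
    have hΩ₀s : Ω₀ ⊆ Ω := connectedComponentIn_subset _ _
    have hoΩ₀ : o ∈ Ω₀ := mem_connectedComponentIn hoΩ
    have hfr₀ : frontier Ω₀ = frontier Ω :=
      frontier_full hΩ.2 (comp_frontier_subset hΩ.1 subset_rfl o)
        (Set.disjoint_left.2 (fun z hz => hΩC z (hΩ₀s hz))) hoΩ₀ (z := x)
        (fun h => hx.2 (subset_closure (hΩ₀s h))) (fun h => hx.2 h.1)
    have n1 : NotSep (J₂ ∪ γ) o x := by
      refine ⟨W', isPreconnected_connectedComponentIn, ho, hxW', ?_⟩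
      rw [Set.disjoint_left]
      rintro z hz (h | h)
      · exact hVJ z (hWs' hz).1 (hJ₂V h)
      · exact (hWs' hz).2 h
    have n2 : NotSep (J₂ ∪ C') o x := by
      refine notSep_join (p := p) (hJ₂.isCompact.union hC'.isCompact).isClosed
        (isPreconnected_connectedComponentIn (F := Ω) (x := o))
        (isPreconnected_connectedComponentIn (F := V \ closure Ω) (x := x)) ?_ ?_ ?_ ?_ hpW.1
        hoΩ₀ hxW
      · rw [Set.disjoint_left]
        rintro z hz (h | h)
        · exact hVJ z (hsub (hΩ₀s hz)) (hJ₂V h)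
        · exact hΩC z (hΩ₀s hz) (hC ▸ Or.inl h)
      · rw [Set.disjoint_left]
        rintro z hz (h | h)
        · exact hVJ z (hWs hz).1 (hJ₂V h)
        · exact (hWs hz).2 (hC ▸ Or.inl h : z ∈ frontier Ω).1
      · rintro (h | h)
        · exact hpV (hJ₂V h)
        · exact hpC h
      · have : p ∈ frontier Ω₀ := by rw [hfr₀, hC]; exact Or.inr hpγ
        exact this.1
    have hinter : (J₂ ∪ γ) ∩ (J₂ ∪ C') = J₂ := by
      rw [← Set.union_inter_distrib_left, Set.inter_comm, hCC]
      apply union_eq_self_of_subset_right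
      rintro z (rfl | rfl)
      exacts [hJ₂.left_mem, hJ₂.right_mem]
    obtain ⟨S, hS, hoS, hxS, hd⟩ := janiszewski (hJ₂.isCompact.union hγ.isCompact)
      (hJ₂.isCompact.union hC'.isCompact) (hinter.symm ▸ hJ₂.isPreconnected) n1 n2
    obtain ⟨y, hyS, hyf⟩ := frontier_meets hS ⟨o, hoS, hoΩ⟩
      ⟨x, hxS, fun h => hx.2 (subset_closure h)⟩
    refine Set.disjoint_left.1 hd hyS ?_
    rw [hC] at hyf
    rcases hyf with h | h
    exacts [Or.inr (Or.inr h), Or.inl (Or.inr h)]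
  have hdc : Disjoint W' (closure Ω) := hdisj.closure_right hop.connectedComponentIn
  exact isPreconnected_connectedComponentIn.subset_connectedComponentIn hxW'
    (fun z hz => ⟨(hWs' hz).1, Set.disjoint_left.1 hdc hz⟩)

lemma side_jordan {V γ J₁ : Set Pl} (hV : IsJordanRegion V) (hVb : Bornology.IsBounded V)
    {a b : Pl} (hγ : IsArc γ a b) (hJ₁ : IsArc J₁ a b) (hJV : J₁ ⊆ frontier V)
    (hγJ : γ ∩ frontier V ⊆ {a, b}) (hγV : γ ⊆ closure V) {x : Pl} (hx : x ∈ V \ γ)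
    (hfr : frontier (connectedComponentIn (V \ γ) x) ⊆ γ ∪ J₁) :
    IsJordanCurve (frontier (connectedComponentIn (V \ γ) x)) ∧
    a ∈ frontier (connectedComponentIn (V \ γ) x) := by
  have hj : IsJordanCurve (γ ∪ J₁) :=
    arc_union_jordan hγ hJ₁ (fun z hz => hγJ ⟨hz.1, hJV hz.2⟩)
  obtain ⟨e, he⟩ := exists_exterior hVb
  have hWs : connectedComponentIn (V \ γ) x ⊆ V \ γ := connectedComponentIn_subset _ _
  have := frontier_full hj hfr (w := x) (z := e) (by
    rw [Set.disjoint_left]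
    rintro z hz (h | h)
    · exact (hWs hz).2 h
    · have := hJV h
      rw [hV.1.frontier_eq] at this
      exact this.2 (hWs hz).1) (mem_connectedComponentIn hx)
    (fun h => he (subset_closure (hWs h).1))
    (fun h => he (union_subset hγV (hJV.trans frontier_subset_closure) h))
  rw [this]
  exact ⟨hj, Or.inl hγ.left_mem⟩

lemma jordan_diff_singleton {J : Set Pl} (hJ : IsJordanCurve J) {a : Pl} (ha : a ∈ J) :
    IsPreconnected (J \ {a}) ∧ (J \ {a}).Nonempty ∧ a ∈ closure (J \ {a}) := by
  obtain ⟨h, hc, rfl, hper, hi, rfl⟩ := jordan_loop hJ ha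
  have h1 : h 1 = h 0 := by simpa using hper 0
  have e : h '' Icc 0 1 \ {h 0} = h '' Ioo 0 1 := by
    ext z
    constructor
    · rintro ⟨⟨t, ht, rfl⟩, hne⟩
      refine ⟨t, ⟨lt_of_le_of_ne ht.1 ?_, lt_of_le_of_ne ht.2 ?_⟩, rfl⟩
      · intro e; exact hne (by rw [← e]; rfl)
      · intro e; exact hne (by rw [e, h1]; rfl)
    · rintro ⟨t, ht, rfl⟩
      refine ⟨⟨t, Ioo_subset_Icc_self ht, rfl⟩, fun e => ?_⟩
      have := hi 0 (x₁ := t) (x₂ := 0) ⟨ht.1.le, by linarith [ht.2]⟩ ⟨le_rfl, by norm_num⟩ e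
      linarith [ht.1]
  rw [e]
  refine ⟨isPreconnected_Ioo.image _ hc.continuousOn, ⟨h (1/2), 1/2, by norm_num, rfl⟩, ?_⟩
  apply image_closure_subset_closure_image hc
  refine ⟨0, ?_, rfl⟩
  rw [closure_Ioo (by norm_num)]
  simp

lemma part_two (Ω V : Set Pl) (hΩ : IsJordanRegion Ω) (hV : IsJordanRegion V)
    (hΩb : Bornology.IsBounded Ω) (hsub : Ω ⊆ V) (hcl : closure Ω ⊆ closure V)
    {a : Pl} (ha : frontier Ω ∩ frontier V = {a}) : ¬ IsJordanRegion (V \ closure Ω) := by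
  intro hD
  set D := V \ closure Ω with hDdef
  have haa : a ∈ frontier Ω ∩ frontier V := by rw [ha]; rfl
  have hVJ : ∀ z ∈ V, z ∉ frontier V := fun z hz h => by
    rw [hV.1.frontier_eq] at h; exact h.2 hz
  have hclΩ : closure Ω = Ω ∪ frontier Ω := by
    rw [closure_eq_self_union_frontier]
  obtain ⟨hC1, hC2, hC3⟩ := jordan_diff_singleton hΩ.2 haa.1
  obtain ⟨hJ1, hJ2, hJ3⟩ := jordan_diff_singleton hV.2 haa.2
  have hJD : frontier V \ {a} ⊆ frontier D := by
    rintro q ⟨hq, hqa⟩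
    have hqn : q ∉ closure Ω := by
      rw [hclΩ]
      rintro (h | h)
      · exact hVJ q (hsub h) hq
      · exact hqa (ha ▸ ⟨h, hq⟩)
    rw [hD.1.frontier_eq]
    refine ⟨?_, fun h => hVJ q h.1 hq⟩
    rw [_root_.mem_closure_iff]
    intro o ho hqo
    obtain ⟨z, ⟨hz1, hz2⟩, hz3⟩ := mem_closure_iff.1 hq.1 (o ∩ (closure Ω)ᶜ)
      (ho.inter isClosed_closure.isOpen_compl) ⟨hqo, hqn⟩
    exact ⟨z, hz1, hz3, hz2⟩
  have hCD : frontier Ω \ {a} ⊆ frontier D := by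
    rintro q ⟨hq, hqa⟩
    have hqV : q ∈ V := by
      have := hcl hq.1
      rw [closure_eq_self_union_frontier] at this
      exact this.resolve_right (fun h => hqa (ha ▸ ⟨hq, h⟩))
    rw [hD.1.frontier_eq]
    refine ⟨?_, fun h => h.2 hq.1⟩
    have hΩn : Ω.Nonempty := by
      rw [← closure_nonempty_iff]; exact ⟨q, hq.1⟩
    obtain ⟨y, hy⟩ := hΩn
    obtain ⟨e, he⟩ := exists_exterior hΩb
    obtain ⟨-, -, hE, hEf⟩ := exterior_comp hΩ hy he
    rw [← hEf] at hq
    rw [_root_.mem_closure_iff]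
    intro o ho hqo
    obtain ⟨z, ⟨hz1, hz2⟩, hz3⟩ := mem_closure_iff.1 hq.1 (o ∩ V) (ho.inter hV.1) ⟨hqo, hqV⟩
    exact ⟨z, hz1, hz2, Set.disjoint_left.1 hE hz3⟩
  have haD : a ∈ frontier D := by
    have := closure_mono hJD hJ3
    rwa [isClosed_frontier.closure_eq] at this
  have hDs : frontier D ⊆ frontier Ω ∪ frontier V := by
    intro y hy
    rw [hD.1.frontier_eq] at hy
    have h1 : y ∈ closure V := closure_mono sdiff_subset hy.1
    rw [closure_eq_self_union_frontier] at h1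
    rcases h1 with h1 | h1
    · left
      have h2 : y ∈ closure Ω := by
        by_contra h; exact hy.2 ⟨h1, h⟩
      rw [hclΩ] at h2
      refine h2.resolve_left (fun h => ?_)
      obtain ⟨z, hz1, hz2⟩ := mem_closure_iff.1 hy.1 Ω hΩ.1 h
      exact hz2.2 (subset_closure hz1)
    · exact Or.inr h1
  obtain ⟨hD1, -, -⟩ := jordan_diff_singleton hD.2 haD
  obtain ⟨c, hc⟩ := hC2
  obtain ⟨j, hj⟩ := hJ2
  obtain ⟨z, hz, hz1, hz2⟩ := isPreconnected_closed_iff.1 hD1 (frontier Ω) (frontier V)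
    isClosed_frontier isClosed_frontier (sdiff_subset.trans hDs)
    ⟨c, ⟨hCD hc, hc.2⟩, hc.1⟩ ⟨j, ⟨hJD hj, hj.2⟩, hj.1⟩
  exact hz.2 (ha ▸ ⟨hz1, hz2⟩)

theorem statement19 (Ω V : Set (EuclideanSpace ℝ (Fin 2)))
    (hΩ : IsJordanRegion Ω) (hV : IsJordanRegion V)
    (hΩb : Bornology.IsBounded Ω) (hVb : Bornology.IsBounded V)
    (hsub : Ω ⊆ V) (hcl : closure Ω ⊆ closure V) :
    ((frontier Ω ∩ frontier V).Nontrivial →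
      ∀ x ∈ V \ closure Ω,
        IsJordanRegion (connectedComponentIn (V \ closure Ω) x) ∧
        (frontier (connectedComponentIn (V \ closure Ω) x) ∩ frontier Ω).Nonempty ∧
        (frontier (connectedComponentIn (V \ closure Ω) x) ∩ frontier V).Nonempty) ∧
    ((∃ a, frontier Ω ∩ frontier V = {a}) → ¬ IsJordanRegion (V \ closure Ω)) := by
  refine ⟨fun hn x hx => ?_, fun ⟨a, ha⟩ => part_two Ω V hΩ hV hΩb hsub hcl ha⟩
  have hop : IsOpen (V \ closure Ω) := hV.1.sdiff isClosed_closure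
  have hWo : IsOpen (connectedComponentIn (V \ closure Ω) x) := hop.connectedComponentIn
  have hWs : connectedComponentIn (V \ closure Ω) x ⊆ V \ closure Ω :=
    connectedComponentIn_subset _ _
  have hVJ : ∀ z ∈ V, z ∉ frontier V := fun z hz h => by
    rw [hV.1.frontier_eq] at h; exact h.2 hz
  have hΩC : ∀ z ∈ Ω, z ∉ frontier Ω := fun z hz h => by
    rw [hΩ.1.frontier_eq] at h; exact h.2 hz
  by_cases hcase : frontier (connectedComponentIn (V \ closure Ω) x) ⊆ frontier V
  · obtain ⟨e, he⟩ := exists_exterior hVb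
    have hfull := frontier_full hV.2 hcase (w := x) (z := e)
      (Set.disjoint_left.2 (fun z hz => hVJ z (hWs hz).1)) (mem_connectedComponentIn hx)
      (fun h => he (subset_closure (hWs h).1)) (fun h => he h.1)
    refine ⟨⟨hWo, hfull ▸ hV.2⟩, ?_, ?_⟩
    · rw [hfull, Set.inter_comm]; exact hn.nonempty
    · rw [hfull, Set.inter_self]; exact hn.nonempty.mono inter_subset_right
  · obtain ⟨p, hpW, hpV⟩ := Set.not_subset.1 hcase
    have hpC : p ∈ frontier Ω := by
      have h1 : p ∈ closure V := closure_mono (hWs.trans sdiff_subset) hpW.1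
      rw [closure_eq_self_union_frontier] at h1
      have h1 := h1.resolve_right hpV
      have h2 : p ∈ closure Ω := by
        by_contra h
        exact Set.disjoint_left.1 (frontier_comp_subset hop x) hpW ⟨h1, h⟩
      rw [closure_eq_self_union_frontier] at h2
      refine h2.resolve_left (fun h => ?_)
      obtain ⟨z, hz1, hz2⟩ := mem_closure_iff.1 hpW.1 Ω hΩ.1 h
      exact (hWs hz2).2 (subset_closure hz1)
    obtain ⟨a, b, γ, C', hab, haC, hbC, hγ, hC', hC, hCC, hγJ, hpγ⟩ :=
      crosscut hΩ.2 isClosed_frontier hn hpC hpV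
    obtain ⟨J₁, J₂, hJ₁, hJ₂, hJ, hJJ⟩ := jordan_split hV.2 haC.2 hbC.2 hab
    have hpC' : p ∉ C' := fun h => by
      have : p ∈ ({a, b} : Set Pl) := hCC ▸ ⟨h, hpγ⟩
      rcases this with rfl | rfl
      exacts [hpV haC.2, hpV hbC.2]
    have hγΩ : γ ⊆ closure Ω := fun z hz => by
      have : z ∈ frontier Ω := hC ▸ Or.inr hz
      exact this.1
    have hγV : γ ⊆ closure V := hγΩ.trans hcl
    have hxγ : x ∈ V \ γ := ⟨hx.1, fun h => hx.2 (hγΩ h)⟩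
    have hJ₁V : J₁ ⊆ frontier V := hJ ▸ subset_union_left
    have hJ₂V : J₂ ⊆ frontier V := hJ ▸ subset_union_right
    have heq := comp_eq hΩ hV hsub hγ hC' hC hCC hJ₂ hJ₂V hx hpV hpC' hpγ hpW
    have hfin : IsJordanCurve (frontier (connectedComponentIn (V \ γ) x)) ∧
        a ∈ frontier (connectedComponentIn (V \ γ) x) := by
      rcases crosscut_side hV hVb hγ hJ₁ hJ₂ hJ hJJ hγV hxγ with h | h
      · exact side_jordan hV hVb hγ hJ₁ hJ₁V hγJ hγV hxγ h
      · exact side_jordan hV hVb hγ hJ₂ hJ₂V hγJ hγV hxγ h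
    rw [← heq] at hfin
    exact ⟨⟨hWo, hfin.1⟩, ⟨a, hfin.2, haC.1⟩, ⟨a, hfin.2, haC.2⟩⟩
end
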